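/- Let A be an (n, V, D)-Lat-Igusa-Todorov algebra. Then findim(A) ≤ ψ_[D](V) + n + 1 < ∞; in particular the finitistic dimension of A is finite. -/

import Mathlib

/-!
Common framework for formalizing "On Lat-Igusa-Todorov algebras" (Barrios–Mata).

For a ring `S`, `FGMod S` is the "category" of finitely generated (left) `S`-modules;
for an Artin algebra `A`, the category `mod A` of finitely generated *right*
`A`-modules is `FGMod Aᵐᵒᵖ`.
-/

universe u v

open Function

namespace LIT

/-- The `η` invariant from Fitting's Lemma: for an endomorphism `L` of an abelian
group `G` and a subgroup `X`, the least `k` such that for all `m ≥ k` the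
restriction of `L` to `L^m(X)` is a monomorphism `L^m(X) → L^{m+1}(X)`. -/
noncomputable def eta {G : Type v} [AddCommGroup G] (L : AddMonoid.End G)
    (X : AddSubgroup G) : ℕ :=
  sInf {k : ℕ | ∀ m : ℕ, k ≤ m → Set.InjOn L (X.map (L ^ m) : Set G)}

/-- Bundled finitely generated `S`-modules. -/
structure FGMod (S : Type u) [Ring S] : Type (u + 1) where
  carrier : Type u
  [isAddCommGroup : AddCommGroup carrier]
  [isModule : Module S carrier]
  [isFinite : Module.Finite S carrier]

attribute [instance] FGMod.isAddCommGroup FGMod.isModule FGMod.isFinite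

/-- The regular module `S` over itself. -/
def FGMod.regular (S : Type u) [Ring S] : FGMod S := ⟨S⟩

/-- A ring is finitely generated as a right module over itself. -/
instance (A : Type u) [Ring A] : Module.Finite Aᵐᵒᵖ A :=
  Module.Finite.of_surjective
    ({ toFun := MulOpposite.unop
       map_add' := fun _ _ => rfl
       map_smul' := fun _ _ => rfl } : Aᵐᵒᵖ →ₗ[Aᵐᵒᵖ] A)
    (fun x => ⟨MulOpposite.op x, rfl⟩)

namespace FGMod

variable {S : Type u} [Ring S]

/-- Projectivity of a module. -/
def IsProj (M : FGMod S) : Prop := Module.Projective S M.carrier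

/-- Direct sum (product) of two modules. -/
def prodMod (M N : FGMod S) : FGMod S := ⟨M.carrier × N.carrier⟩

/-- Finite direct sums. -/
def dsum {n : ℕ} (f : Fin n → FGMod S) : FGMod S := ⟨∀ i, (f i).carrier⟩

/-- `N` is a direct summand of `M`. -/
def IsSummand (N M : FGMod S) : Prop :=
  ∃ N' : FGMod S, Nonempty (M.carrier ≃ₗ[S] N.carrier × N'.carrier)

/-- `addOf C` is `add C`: all direct summands of finite direct sums of modules of `C`. -/
def addOf (C : Set (FGMod S)) : Set (FGMod S) :=
  {N | ∃ (n : ℕ) (f : Fin n → FGMod S), (∀ i, f i ∈ C) ∧ IsSummand N (dsum f)}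

/-- `f : P → M` is a projective cover: `P` projective, `f` surjective with superfluous kernel. -/
def IsProjCover {P M : FGMod S} (f : P.carrier →ₗ[S] M.carrier) : Prop :=
  P.IsProj ∧ Surjective f ∧
    ∀ N : Submodule S P.carrier, N ⊔ LinearMap.ker f = ⊤ → N = ⊤

/-- `N` is (isomorphic to) the syzygy `Ω(M)`, i.e. the kernel of a projective cover of `M`. -/
def IsSyzygyOf (N M : FGMod S) : Prop :=
  ∃ (P : FGMod S) (f : P.carrier →ₗ[S] M.carrier),
    IsProjCover f ∧ Nonempty (N.carrier ≃ₗ[S] LinearMap.ker f)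

/-- The syzygy `Ω(M)` of `M` (a choice of it; over an Artin algebra it exists and is
unique up to isomorphism). -/
noncomputable def syz (M : FGMod S) : FGMod S :=
  letI := Classical.propDecidable (∃ N, IsSyzygyOf N M)
  if h : ∃ N, IsSyzygyOf N M then h.choose else M

/-- `SES X Y Z` : there is a short exact sequence `0 → X → Y → Z → 0`. -/
def SES (X Y Z : FGMod S) : Prop :=
  ∃ (f : X.carrier →ₗ[S] Y.carrier) (g : Y.carrier →ₗ[S] Z.carrier),
    Injective f ∧ Surjective g ∧ LinearMap.range f = LinearMap.ker g

/-- Projective dimension, via vanishing of syzygies. -/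
noncomputable def pdim (M : FGMod S) : ℕ∞ :=
  sInf ((↑) '' {n : ℕ | (syz^[n] M).IsProj})

end FGMod

open FGMod

variable {S : Type u} [Ring S]

/-- The finitistic dimension of a class of modules: the supremum of the projective
dimensions of its modules of finite projective dimension. -/
noncomputable def findim (C : Set (FGMod S)) : ℕ∞ :=
  ⨆ M ∈ {M ∈ C | pdim M ≠ ⊤}, pdim M

/-- The global dimension of a class of modules. -/
noncomputable def gldim (C : Set (FGMod S)) : ℕ∞ :=
  ⨆ M ∈ C, pdim M

/-- The defining relations of `K₀`: `[M] - [M'] - [M'']` for `M ≅ M' ⊕ M''`, and `[P]`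
for `P` projective. -/
def K0Rels (S : Type u) [Ring S] : AddSubgroup (FreeAbelianGroup (FGMod S)) :=
  AddSubgroup.closure
    ({x | ∃ M M' M'' : FGMod S,
        Nonempty (M.carrier ≃ₗ[S] M'.carrier × M''.carrier) ∧
        x = FreeAbelianGroup.of M - FreeAbelianGroup.of M' - FreeAbelianGroup.of M''} ∪
      {x | ∃ P : FGMod S, P.IsProj ∧ x = FreeAbelianGroup.of P})

/-- `K₀(A)`: the free abelian group on the modules modulo the relations above. -/
abbrev K0 (S : Type u) [Ring S] : Type (u + 1) :=
  FreeAbelianGroup (FGMod S) ⧸ K0Rels S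

/-- The class `[M]` of a module in `K₀`. -/
def toK0 (M : FGMod S) : K0 S := QuotientAddGroup.mk (FreeAbelianGroup.of M)

/-- `⟨C⟩`: the subgroup of `K₀` generated by the classes of direct summands of
modules of `C`. -/
def grpOf (C : Set (FGMod S)) : AddSubgroup (K0 S) :=
  AddSubgroup.closure {x | ∃ N M : FGMod S, M ∈ C ∧ IsSummand N M ∧ x = toK0 N}

/-- `K_D = K₀/⟨D⟩`. -/
abbrev KD (D : Set (FGMod S)) : Type (u + 1) := K0 S ⧸ grpOf D

/-- The class of a module in `K_D`. -/
def toKD (D : Set (FGMod S)) (M : FGMod S) : KD D :=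
  QuotientAddGroup.mk (toK0 M)

/-- `L` is the endomorphism `Ω̄` of `K₀` induced by the syzygy operator (it is unique). -/
def IsSyzEnd (L : AddMonoid.End (K0 S)) : Prop :=
  ∀ M : FGMod S, L (toK0 M) = toK0 (syz M)

/-- `L` is the endomorphism `Ω̄_D` of `K_D` induced by the syzygy operator. -/
def IsSyzEndD (D : Set (FGMod S)) (L : AddMonoid.End (KD D)) : Prop :=
  ∀ M : FGMod S, L (toKD D M) = toKD D (syz M)

/-- The Igusa–Todorov function `φ`, relative to the induced endomorphism `L = Ω̄` of `K₀`. -/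
noncomputable def phi (L : AddMonoid.End (K0 S)) (M : FGMod S) : ℕ :=
  eta L (grpOf {M})

/-- `φ`-dimension of a class of modules. -/
noncomputable def phidim (L : AddMonoid.End (K0 S)) (C : Set (FGMod S)) : ℕ∞ :=
  ⨆ M ∈ C, (phi L M : ℕ∞)

/-- The generalized Igusa–Todorov function `φ_[D]`, relative to `L = Ω̄_D`. -/
noncomputable def phiD (D : Set (FGMod S)) (L : AddMonoid.End (KD D)) (M : FGMod S) : ℕ :=
  eta L ((grpOf {M}).map (QuotientAddGroup.mk' (grpOf D)))

/-- The generalized Igusa–Todorov function `ψ_[D]`. -/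
noncomputable def psiD (D : Set (FGMod S)) (L : AddMonoid.End (KD D)) (M : FGMod S) : ℕ∞ :=
  (phiD D L M : ℕ∞) + findim (addOf {syz^[phiD D L M] M})

/-- `D` is a `0`-Igusa–Todorov subcategory: `D = add D`, `Ω(D) ⊆ D` and `φdim D = 0`. -/
def IsZeroIT (L : AddMonoid.End (K0 S)) (D : Set (FGMod S)) : Prop :=
  D = addOf D ∧ (∀ M ∈ D, syz M ∈ D) ∧ phidim L D = 0

/-- The class `C` is `(n,V,D)`-Lat-Igusa-Todorov: every `M ∈ C` admits an exact sequence
`0 → V₁ ⊕ D₁ → V₀ ⊕ D₀ → Ωⁿ(M) → 0` with `V₁, V₀ ∈ add V` and `D₁, D₀ ∈ D`. -/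
def IsLITClass (n : ℕ) (V : FGMod S) (D : Set (FGMod S)) (C : Set (FGMod S)) : Prop :=
  ∀ M ∈ C, ∃ V1 V0 D1 D0 : FGMod S,
    V1 ∈ addOf {V} ∧ V0 ∈ addOf {V} ∧ D1 ∈ D ∧ D0 ∈ D ∧
    SES (prodMod V1 D1) (prodMod V0 D0) (syz^[n] M)

/-- `[C]_D`: the image of `⟨C⟩` in `K_D`, i.e. `(⟨C⟩ + ⟨D⟩)/⟨D⟩`. -/
def classGrpD (D C : Set (FGMod S)) : AddSubgroup (KD D) :=
  (grpOf C).map (QuotientAddGroup.mk' (grpOf D))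

/-- `C` is `D`-syzygy finite: `[Ω^k(C)]_D` is finitely generated for some `k`. -/
def DSyzFinite (D C : Set (FGMod S)) : Prop :=
  ∃ k : ℕ, (classGrpD D ((fun M => syz^[k] M) '' C)).FG

/-- The algebra is `n`-LIT: there are a `0`-Igusa–Todorov subcategory `D` and a module `V`
such that `mod A` is `(n,V,D)`-LIT. -/
def IsNLITAlgebra (L : AddMonoid.End (K0 S)) (n : ℕ) : Prop :=
  ∃ (V : FGMod S) (D : Set (FGMod S)), IsZeroIT L D ∧ IsLITClass n V D Set.univ

/-- The algebra is LIT: it is `n`-LIT for some `n`. -/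
def IsLITAlgebra (L : AddMonoid.End (K0 S)) : Prop :=
  ∃ n : ℕ, IsNLITAlgebra L n


namespace FGMod

/-! ### The monoid of isomorphism classes -/

/-- Isomorphism of finitely generated modules. -/
def isoSetoid (S : Type u) [Ring S] : Setoid (FGMod S) where
  r M N := Nonempty (M.carrier ≃ₗ[S] N.carrier)
  iseqv := ⟨fun _ => ⟨.refl _ _⟩, fun ⟨e⟩ => ⟨e.symm⟩, fun ⟨e⟩ ⟨f⟩ => ⟨e.trans f⟩⟩

/-- Isomorphism classes of finitely generated modules. -/
def IsoClass (S : Type u) [Ring S] : Type (u + 1) := Quotient (isoSetoid S)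

/-- The isomorphism class of a module. -/
def cls (M : FGMod S) : IsoClass S := Quotient.mk (isoSetoid S) M

theorem cls_eq {M N : FGMod S} : cls M = cls N ↔ Nonempty (M.carrier ≃ₗ[S] N.carrier) :=
  Quotient.eq (r := isoSetoid S)

theorem exists_cls (x : IsoClass S) : ∃ M, cls M = x := Quotient.exists_rep x

/-- The zero module. -/
def zeroMod (S : Type u) [Ring S] : FGMod S := ⟨PUnit⟩

instance : Unique (zeroMod S).carrier := inferInstanceAs (Unique PUnit)

instance : Zero (IsoClass S) := ⟨cls (zeroMod S)⟩

instance : Add (IsoClass S) :=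
  ⟨Quotient.map₂ prodMod fun _ _ ⟨e⟩ _ _ ⟨f⟩ => ⟨e.prodCongr f⟩⟩

/-- Direct sum makes isomorphism classes a commutative monoid. -/
instance : AddCommMonoid (IsoClass S) where
  add_assoc := by
    rintro ⟨a⟩ ⟨b⟩ ⟨c⟩
    exact Quotient.sound ⟨LinearEquiv.prodAssoc S _ _ _⟩
  zero_add := by
    rintro ⟨a⟩
    exact Quotient.sound ⟨LinearEquiv.uniqueProd⟩
  add_zero := by
    rintro ⟨a⟩
    exact Quotient.sound ⟨LinearEquiv.prodUnique⟩
  add_comm := by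
    rintro ⟨a⟩ ⟨b⟩
    exact Quotient.sound ⟨LinearEquiv.prodComm S _ _⟩
  nsmul := nsmulRec

theorem cls_prodMod (M N : FGMod S) : cls (prodMod M N) = cls M + cls N := rfl

theorem cls_zeroMod : cls (zeroMod S) = 0 := rfl

theorem cls_eq_add {M A B : FGMod S} :
    cls M = cls A + cls B ↔ Nonempty (M.carrier ≃ₗ[S] A.carrier × B.carrier) :=
  cls_eq (N := prodMod A B)

theorem isSummand_iff {N M : FGMod S} : IsSummand N M ↔ ∃ x, cls M = cls N + x := by
  constructor
  · rintro ⟨N', h⟩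
    exact ⟨cls N', cls_eq_add.2 h⟩
  · rintro ⟨x, h⟩
    obtain ⟨N', rfl⟩ := exists_cls x
    exact ⟨N', cls_eq_add.1 h⟩

theorem IsSummand.trans {L M N : FGMod S} (h : IsSummand L M) (h' : IsSummand M N) :
    IsSummand L N := by
  rw [isSummand_iff] at *
  obtain ⟨x, hx⟩ := h
  obtain ⟨y, hy⟩ := h'
  exact ⟨x + y, by rw [hy, hx, add_assoc]⟩

theorem IsSummand.refl (M : FGMod S) : IsSummand M M :=
  isSummand_iff.2 ⟨0, (add_zero _).symm⟩

theorem cls_eq_zero {M : FGMod S} (h : Subsingleton M.carrier) : cls M = 0 :=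
  cls_eq.2 ⟨⟨⟨⟨fun _ => PUnit.unit, fun _ _ => rfl⟩, fun _ _ => rfl⟩, fun _ => 0,
    fun _ => Subsingleton.elim _ _, fun _ => rfl⟩⟩

/-- A split monomorphism exhibits its source as a direct summand. -/
theorem isSummand_of_comp_eq_id {N A : FGMod S} (s : N.carrier →ₗ[S] A.carrier)
    (r : A.carrier →ₗ[S] N.carrier) (h : r ∘ₗ s = LinearMap.id) [IsNoetherianRing S] :
    IsSummand N A := by
  have h' : ∀ x, r (s x) = x := fun x => LinearMap.congr_fun h x
  refine ⟨⟨LinearMap.ker r⟩, ⟨LinearEquiv.ofLinearMap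
    (r.prod ((LinearMap.id - s ∘ₗ r).codRestrict (LinearMap.ker r) fun x => by simp [h']))
    (s.coprod (LinearMap.ker r).subtype) ?_ ?_⟩⟩
  · ext x
    · simp [h']
    · simp [h']
    · simp
    · simp
  · ext x
    simp

/-- Indecomposable modules. -/
def Indec (N : FGMod S) : Prop :=
  Nontrivial N.carrier ∧
    ∀ X Y : FGMod S, cls N = cls X + cls Y → Subsingleton X.carrier ∨ Subsingleton Y.carrier

section Artinian

variable [IsArtinianRing S]

/-- Fitting's lemma: an endomorphism of an indecomposable module is nilpotent or invertible. -/
theorem Indec.isNilpotent_or_isUnit {N : FGMod S} (hN : Indec N) (f : Module.End S N.carrier) :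
    IsNilpotent f ∨ IsUnit f := by
  obtain ⟨k, hk, hk0⟩ := (f.eventually_isCompl_ker_pow_range_pow.and
    (Filter.eventually_ge_atTop 1)).exists
  have := hN.2 ⟨LinearMap.ker (f ^ k)⟩ ⟨LinearMap.range (f ^ k)⟩
    (cls_eq_add.2 ⟨(Submodule.prodEquivOfIsCompl _ _ hk).symm⟩)
  rcases this with h | h
  · right
    have hb := Submodule.subsingleton_iff_eq_bot.1 h
    have ht := hk.sup_eq_top
    rw [hb, bot_sup_eq] at ht
    have : IsUnit (f ^ k) := (Module.End.isUnit_iff _).2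
      ⟨LinearMap.ker_eq_bot.1 hb, LinearMap.range_eq_top.1 ht⟩
    exact (isUnit_pow_iff (by omega)).1 this
  · left
    have hb := Submodule.subsingleton_iff_eq_bot.1 h
    exact ⟨k, LinearMap.range_eq_bot.1 hb⟩

theorem Indec.isLocalRing {N : FGMod S} (hN : Indec N) : IsLocalRing (Module.End S N.carrier) := by
  have := hN.1
  refine IsLocalRing.of_isUnit_or_isUnit_one_sub_self fun f => ?_
  rcases hN.isNilpotent_or_isUnit f with h | h
  · exact Or.inr h.isUnit_one_sub
  · exact Or.inl h

theorem isSummand_of_isUnit_comp {N A : FGMod S} (s : N.carrier →ₗ[S] A.carrier)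
    (r : A.carrier →ₗ[S] N.carrier) (h : IsUnit (r ∘ₗ s : Module.End S N.carrier)) :
    IsSummand N A := by
  obtain ⟨g, hg⟩ := h.exists_left_inv
  exact isSummand_of_comp_eq_id s (g ∘ₗ r) hg

/-- Indecomposable modules are prime for direct sums. -/
theorem Indec.summand_or {N A B : FGMod S} (hN : Indec N) {x : IsoClass S}
    (h : cls N + x = cls A + cls B) : IsSummand N A ∨ IsSummand N B := by
  have := hN.isLocalRing
  obtain ⟨X, rfl⟩ := exists_cls x
  obtain ⟨e⟩ := cls_eq.1 (show cls (prodMod N X) = cls (prodMod A B) from h)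
  change (N.carrier × X.carrier) ≃ₗ[S] (A.carrier × B.carrier) at e
  let i := e.toLinearMap ∘ₗ LinearMap.inl S N.carrier X.carrier
  let p := LinearMap.fst S N.carrier X.carrier ∘ₗ e.symm.toLinearMap
  have key : ((p ∘ₗ LinearMap.inl S _ _) ∘ₗ (LinearMap.fst S _ _ ∘ₗ i) : Module.End S N.carrier) +
      ((p ∘ₗ LinearMap.inr S _ _) ∘ₗ (LinearMap.snd S _ _ ∘ₗ i) : Module.End S N.carrier) = 1 := by
    ext x
    have : (((e (x, 0)).1, 0) : A.carrier × B.carrier) + (0, (e (x, 0)).2) = e (x, 0) := by simp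
    simp only [LinearMap.add_apply, LinearMap.comp_apply, i, p, LinearMap.inl_apply,
      LinearMap.inr_apply, LinearMap.fst_apply, LinearMap.snd_apply, LinearEquiv.coe_coe]
    rw [← Prod.fst_add, ← map_add, this]
    simp
  rcases IsLocalRing.isUnit_or_isUnit_of_add_one key with h | h
  · exact Or.inl (isSummand_of_isUnit_comp _ _ h)
  · exact Or.inr (isSummand_of_isUnit_comp _ _ h)

/-- Every module is a finite direct sum of indecomposable summands, in the form of an induction
principle. -/
theorem indec_induction {P : IsoClass S → Prop} (h0 : P 0)
    (hadd : ∀ x y, P x → P y → P (x + y)) (M : FGMod S)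
    (hind : ∀ N, Indec N → IsSummand N M → P (cls N)) : P (cls M) := by
  suffices ∀ (k : ℕ) (N : FGMod S), Module.length S N.carrier ≤ k → IsSummand N M → P (cls N) by
    obtain ⟨k, hk⟩ := ENat.ne_top_iff_exists.1 (Module.length_ne_top (R := S) (M := M.carrier))
    exact this k M hk.ge (.refl M)
  intro k
  induction k with
  | zero =>
    intro N hN _
    rw [cls_eq_zero (Module.length_eq_zero_iff.1 (by simpa using hN))]
    exact h0
  | succ k ih =>
    intro N hN hNM
    by_cases hs : Subsingleton N.carrier
    · rw [cls_eq_zero hs]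
      exact h0
    by_cases hi : Indec N
    · exact hind N hi hNM
    have hnt := not_subsingleton_iff_nontrivial.1 hs
    simp only [Indec, hnt, true_and, not_forall, not_or, not_subsingleton_iff_nontrivial] at hi
    obtain ⟨X, Y, hXY, hX, hY⟩ := hi
    have hlen : Module.length S N.carrier =
        Module.length S X.carrier + Module.length S Y.carrier := by
      rw [(cls_eq_add.1 hXY).some.length_eq, Module.length_prod]
    have hX1 := Module.length_pos (R := S) (M := X.carrier)
    have hY1 := Module.length_pos (R := S) (M := Y.carrier)
    obtain ⟨a, ha⟩ := ENat.ne_top_iff_exists.1 (Module.length_ne_top (R := S) (M := X.carrier))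
    obtain ⟨b, hb⟩ := ENat.ne_top_iff_exists.1 (Module.length_ne_top (R := S) (M := Y.carrier))
    rw [← ha] at hX1 hlen
    rw [← hb] at hY1 hlen
    rw [hlen] at hN
    norm_cast at hN hX1 hY1
    rw [hXY]
    refine hadd _ _ (ih X ?_ (.trans (isSummand_iff.2 ⟨_, hXY⟩) hNM))
      (ih Y ?_ (.trans (isSummand_iff.2 ⟨_, hXY.trans (add_comm _ _)⟩) hNM))
    · rw [← ha]; norm_cast; omega
    · rw [← hb]; norm_cast; omega

end Artinian

/-- If the corner of an isomorphism of direct sums is invertible then the complements are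
isomorphic. -/
theorem nonempty_equiv_of_isUnit_corner {N A B : FGMod S}
    (e : (N.carrier × A.carrier) ≃ₗ[S] (N.carrier × B.carrier))
    (h : IsUnit (LinearMap.fst S _ _ ∘ₗ e.toLinearMap ∘ₗ LinearMap.inl S _ _ :
      Module.End S N.carrier)) : Nonempty (A.carrier ≃ₗ[S] B.carrier) := by
  obtain ⟨hi, hs⟩ := (Module.End.isUnit_iff _).1 h
  obtain ⟨g, hg⟩ := h.exists_left_inv
  obtain ⟨g', hg'⟩ := h.exists_right_inv
  have hgg : g = g' := left_inv_eq_right_inv hg hg'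
  subst hgg
  replace hg : ∀ x, g (e (x, 0)).1 = x := fun x => LinearMap.congr_fun hg x
  replace hg' : ∀ x, (e (g x, 0)).1 = x := fun x => LinearMap.congr_fun hg' x
  have hsplit : ∀ x a, e (x, a) = e (x, 0) + e (0, a) := fun x a => by
    rw [← map_add]; simp
  let k : A.carrier →ₗ[S] B.carrier :=
    LinearMap.snd S _ _ ∘ₗ e.toLinearMap ∘ₗ
      (-(g ∘ₗ LinearMap.fst S _ _ ∘ₗ e.toLinearMap ∘ₗ LinearMap.inr S _ _)).prod LinearMap.id
  have hk : ∀ a, e (-g (e (0, a)).1, a) = (0, k a) := fun a => by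
    refine Prod.ext ?_ rfl
    rw [hsplit, Prod.fst_add, show ((-g (e (0, a)).1, 0) : N.carrier × A.carrier) =
      -(g (e (0, a)).1, 0) by simp, map_neg, Prod.fst_neg, hg']
    simp
  refine ⟨LinearEquiv.ofBijective k ⟨?_, ?_⟩⟩
  · refine (injective_iff_map_eq_zero k).2 fun a ha => ?_
    have := hk a
    rw [ha, Prod.mk_zero_zero, e.map_eq_zero_iff] at this
    exact (Prod.ext_iff.1 this).2
  · intro b
    obtain ⟨⟨x, a⟩, hxa⟩ := e.surjective (0, b)
    refine ⟨a, ?_⟩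
    have h1 : x = -g (e (0, a)).1 := by
      rw [hsplit, Prod.ext_iff, Prod.fst_add] at hxa
      have := congrArg g hxa.1
      simp only [map_add, hg, map_zero] at this
      exact eq_neg_of_add_eq_zero_left this
    have := hk a
    rw [← h1, hxa] at this
    exact (Prod.ext_iff.1 this).2.symm

section Artinian

variable [IsArtinianRing S]

theorem Indec.add_left_cancel {N : FGMod S} (hN : Indec N) {x y : IsoClass S}
    (h : cls N + x = cls N + y) : x = y := by
  have := hN.isLocalRing
  obtain ⟨A, rfl⟩ := exists_cls x
  obtain ⟨B, rfl⟩ := exists_cls y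
  obtain ⟨e⟩ := cls_eq.1 (show cls (prodMod N A) = cls (prodMod N B) from h)
  change (N.carrier × A.carrier) ≃ₗ[S] (N.carrier × B.carrier) at e
  refine cls_eq.2 ?_
  by_cases hu : IsUnit (LinearMap.fst S _ _ ∘ₗ e.toLinearMap ∘ₗ LinearMap.inl S _ _ :
      Module.End S N.carrier)
  · exact nonempty_equiv_of_isUnit_corner e hu
  let a' := LinearMap.fst S _ _ ∘ₗ e.symm.toLinearMap ∘ₗ LinearMap.inl S N.carrier B.carrier
  let b' := LinearMap.fst S _ _ ∘ₗ e.symm.toLinearMap ∘ₗ LinearMap.inr S N.carrier B.carrier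
  let a : Module.End S N.carrier := LinearMap.fst S _ _ ∘ₗ e.toLinearMap ∘ₗ LinearMap.inl S _ _
  let c := LinearMap.snd S _ _ ∘ₗ e.toLinearMap ∘ₗ LinearMap.inl S N.carrier A.carrier
  have key : (a' : Module.End S N.carrier) * a + (b' ∘ₗ c : Module.End S N.carrier) = 1 := by
    ext x
    have : (((e (x, 0)).1, 0) : N.carrier × B.carrier) + (0, (e (x, 0)).2) = e (x, 0) := by simp
    simp only [LinearMap.add_apply, LinearMap.comp_apply, a', b', a, c, LinearMap.inl_apply,
      LinearMap.inr_apply, LinearMap.fst_apply, LinearMap.snd_apply, LinearEquiv.coe_coe,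
      Module.End.mul_apply]
    rw [← Prod.fst_add, ← map_add, this]
    simp
  have hbc : IsUnit (b' ∘ₗ c : Module.End S N.carrier) := by
    refine (IsLocalRing.isUnit_or_isUnit_of_add_one key).resolve_left fun h => hu ?_
    rcases hN.isNilpotent_or_isUnit a with hn | hu'
    · exfalso
      have hinj : Injective a := by
        have := ((Module.End.isUnit_iff _).1 h).1
        rw [Module.End.mul_eq_comp, LinearMap.coe_comp] at this
        exact this.of_comp
      obtain ⟨k, hk⟩ := hn
      have hinj' : Injective (a ^ k) := by
        rw [Module.End.coe_pow]
        exact hinj.iterate k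
      have := hN.1
      obtain ⟨x, hx⟩ := exists_ne (0 : N.carrier)
      exact hx (hinj' (by simp [hk]))
    · exact hu'
  have hsum : IsUnit (a + (b' ∘ₗ c : Module.End S N.carrier)) := by
    by_contra hns
    have h1 : IsUnit ((a + (b' ∘ₗ c : Module.End S N.carrier)) + -a) := by simpa using hbc
    rcases IsLocalRing.isUnit_or_isUnit_of_isUnit_add h1 with h | h
    · exact hns h
    · exact hu (by simpa [a] using h.neg)
  let sh : (N.carrier × B.carrier) ≃ₗ[S] (N.carrier × B.carrier) := LinearEquiv.ofLinearMap
    ((LinearMap.fst S _ _ + b' ∘ₗ LinearMap.snd S _ _).prod (LinearMap.snd S _ _))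
    ((LinearMap.fst S _ _ - b' ∘ₗ LinearMap.snd S _ _).prod (LinearMap.snd S _ _))
    (by ext <;> simp) (by ext <;> simp)
  exact nonempty_equiv_of_isUnit_corner (e.trans sh) hsum

instance : IsCancelAdd (IsoClass S) :=
  have : IsLeftCancelAdd (IsoClass S) := ⟨fun z => by
    obtain ⟨M, rfl⟩ := exists_cls z
    refine indec_induction (P := fun z => ∀ x y, z + x = z + y → x = y) ?_ ?_ M ?_
    · intro x y h
      simpa using h
    · intro a b ha hb x y h
      rw [add_assoc, add_assoc] at h
      exact hb _ _ (ha _ _ h)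
    · intro N hN _ x y h
      exact hN.add_left_cancel h⟩
  AddCommMagma.IsLeftCancelAdd.toIsCancelAdd _

/-- A module has only finitely many indecomposable summands up to isomorphism. -/
theorem exists_indec_list (M : FGMod S) : ∃ l : List (IsoClass S),
    ∀ N, Indec N → IsSummand N M → cls N ∈ l := by
  suffices ∃ l : List (IsoClass S), ∀ N y, Indec N → cls M = cls N + y → cls N ∈ l by
    obtain ⟨l, hl⟩ := this
    exact ⟨l, fun N hN h => (isSummand_iff.1 h).elim fun y hy => hl N y hN hy⟩
  refine indec_induction (P := fun x => ∃ l : List (IsoClass S),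
    ∀ N y, Indec N → x = cls N + y → cls N ∈ l) ?_ ?_ M ?_
  · refine ⟨[], fun N y hN h => ?_⟩
    obtain ⟨Y, rfl⟩ := exists_cls y
    have e := (cls_eq_add (M := zeroMod S)).1 h
    have := hN.1
    exact absurd (e.some.symm.toEquiv.subsingleton_congr.2
      (inferInstanceAs (Subsingleton PUnit))) (not_subsingleton _)
  · rintro x y ⟨l, hl⟩ ⟨l', hl'⟩
    refine ⟨l ++ l', fun N z hN h => List.mem_append.2 ?_⟩
    obtain ⟨A, rfl⟩ := exists_cls x
    obtain ⟨B, rfl⟩ := exists_cls y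
    refine (hN.summand_or h.symm).imp (fun h => ?_) fun h => ?_
    · exact (isSummand_iff.1 h).elim fun z hz => hl N z hN hz
    · exact (isSummand_iff.1 h).elim fun z hz => hl' N z hN hz
  · intro N hN _
    refine ⟨[cls N], fun N' y hN' h => ?_⟩
    obtain ⟨Y, rfl⟩ := exists_cls y
    rcases hN.2 _ _ h with h' | h'
    · have := hN'.1
      exact absurd h' (not_subsingleton _)
    · rw [h, cls_eq_zero h', add_zero]
      exact List.mem_singleton_self _

/-- An indecomposable summand of a module of `add C` is a summand of a module of `C`. -/
theorem Indec.exists_of_isSummand_dsum {N : FGMod S} (hN : Indec N) {k : ℕ}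
    {f : Fin k → FGMod S} (h : IsSummand N (dsum f)) : ∃ i, IsSummand N (f i) := by
  have := hN.isLocalRing
  obtain ⟨X, ⟨e⟩⟩ := h
  change (∀ i, (f i).carrier) ≃ₗ[S] (N.carrier × X.carrier) at e
  let s : N.carrier →ₗ[S] ∀ i, (f i).carrier := e.symm.toLinearMap ∘ₗ LinearMap.inl S _ _
  let r : (∀ i, (f i).carrier) →ₗ[S] N.carrier := LinearMap.fst S _ _ ∘ₗ e.toLinearMap
  have key : ∑ i, (((r ∘ₗ LinearMap.single S _ i) ∘ₗ (LinearMap.proj i ∘ₗ s) :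
      Module.End S N.carrier)) = 1 := by
    ext x
    rw [LinearMap.sum_apply]
    simp only [LinearMap.comp_apply, LinearMap.single_apply, LinearMap.proj_apply]
    rw [← map_sum, Finset.univ_sum_single]
    simp [r, s]
  obtain ⟨i, -, hi⟩ := IsLocalRing.exists_of_isUnit_sum (key ▸ isUnit_one)
  exact ⟨i, isSummand_of_isUnit_comp _ _ hi⟩

end Artinian

end FGMod

namespace FGMod

/-! ### The group `K₀` and stable isomorphism -/

/-- The classes of projective modules. -/
def projCls (S : Type u) [Ring S] : AddSubmonoid (IsoClass S) where
  carrier := {x | ∃ P : FGMod S, P.IsProj ∧ cls P = x}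
  zero_mem' := ⟨zeroMod S, inferInstanceAs (Module.Projective S PUnit.{u + 1}), cls_zeroMod⟩
  add_mem' := by
    rintro _ _ ⟨P, hP, rfl⟩ ⟨Q, hQ, rfl⟩
    have : Module.Projective S P.carrier := hP
    have : Module.Projective S Q.carrier := hQ
    exact ⟨prodMod P Q, inferInstanceAs (Module.Projective S (P.carrier × Q.carrier)), rfl⟩

theorem cls_mem_projCls {P : FGMod S} : cls P ∈ projCls S ↔ P.IsProj := by
  refine ⟨?_, fun h => ⟨P, h, rfl⟩⟩
  rintro ⟨Q, hQ, h⟩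
  have : Module.Projective S Q.carrier := hQ
  exact Module.Projective.of_equiv (cls_eq.1 h).some

theorem IsProj.of_isSummand {N P : FGMod S} (hP : P.IsProj) (h : IsSummand N P) : N.IsProj := by
  obtain ⟨X, ⟨e⟩⟩ := h
  have : Module.Projective S P.carrier := hP
  refine Module.Projective.of_split (e.symm.toLinearMap ∘ₗ LinearMap.inl S _ _)
    (LinearMap.fst S _ _ ∘ₗ e.toLinearMap) ?_
  ext x
  simp

/-- Isomorphism up to projective summands. -/
def Stab (x y : IsoClass S) : Prop := ∃ p ∈ projCls S, ∃ q ∈ projCls S, x + p = y + q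

theorem toK0_of_isProj {P : FGMod S} (h : P.IsProj) : toK0 P = 0 :=
  (QuotientAddGroup.eq_zero_iff _).2 (AddSubgroup.subset_closure (Or.inr ⟨P, h, rfl⟩))

theorem toK0_of_cls_eq_add {M A B : FGMod S} (h : cls M = cls A + cls B) :
    toK0 M = toK0 A + toK0 B := by
  have : (QuotientAddGroup.mk (FreeAbelianGroup.of M - FreeAbelianGroup.of A -
      FreeAbelianGroup.of B) : K0 S) = 0 :=
    (QuotientAddGroup.eq_zero_iff _).2
      (AddSubgroup.subset_closure (Or.inl ⟨M, A, B, cls_eq_add.1 h, rfl⟩))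
  rw [QuotientAddGroup.mk_sub, QuotientAddGroup.mk_sub, sub_sub, sub_eq_zero] at this
  exact this

theorem toK0_zeroMod : toK0 (zeroMod S) = 0 := toK0_of_isProj (cls_mem_projCls.1 (zero_mem _))

theorem toK0_congr {M N : FGMod S} (h : cls M = cls N) : toK0 M = toK0 N := by
  rw [toK0_of_cls_eq_add (M := M) (A := N) (B := zeroMod S) (by rw [h, cls_zeroMod, add_zero]),
    toK0_zeroMod, add_zero]

/-- The class in `K₀` as a homomorphism from the monoid of isomorphism classes. -/
def k0 : IsoClass S →+ K0 S where
  toFun := Quotient.lift toK0 fun _ _ h => toK0_congr (cls_eq.2 h)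
  map_zero' := toK0_zeroMod
  map_add' := by
    rintro ⟨A⟩ ⟨B⟩
    exact toK0_of_cls_eq_add (M := prodMod A B) rfl

theorem toK0_prodMod (A B : FGMod S) : toK0 (prodMod A B) = toK0 A + toK0 B :=
  toK0_of_cls_eq_add rfl

theorem k0_of_mem_projCls {p : IsoClass S} (hp : p ∈ projCls S) : k0 p = 0 := by
  obtain ⟨P, hP, rfl⟩ := hp
  exact toK0_of_isProj hP

theorem k0_eq_of_stab {x y : IsoClass S} (h : Stab x y) : k0 x = k0 y := by
  obtain ⟨p, hp, q, hq, h⟩ := h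
  have := congrArg k0 h
  rwa [map_add, map_add, k0_of_mem_projCls hp, k0_of_mem_projCls hq, add_zero, add_zero] at this

open Algebra in
/-- Modules with the same class in `K₀` are stably isomorphic. -/
theorem stab_of_k0_eq [IsArtinianRing S] {x y : IsoClass S} (h : k0 x = k0 y) : Stab x y := by
  let ι : IsoClass S →+ GrothendieckAddGroup (IsoClass S) := GrothendieckAddGroup.of
  let F : FreeAbelianGroup (FGMod S) →+ GrothendieckAddGroup (IsoClass S) :=
    FreeAbelianGroup.lift fun M => ι (cls M)
  let H : AddSubgroup (GrothendieckAddGroup (IsoClass S)) :=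
    { carrier := {g | ∃ p ∈ projCls S, ∃ q ∈ projCls S, g = ι p - ι q}
      zero_mem' := ⟨0, zero_mem _, 0, zero_mem _, by simp⟩
      add_mem' := by
        rintro _ _ ⟨p, hp, q, hq, rfl⟩ ⟨p', hp', q', hq', rfl⟩
        exact ⟨p + p', add_mem hp hp', q + q', add_mem hq hq', by
          rw [map_add, map_add]; abel⟩
      neg_mem' := by
        rintro _ ⟨p, hp, q, hq, rfl⟩
        exact ⟨q, hq, p, hp, by abel⟩ }
  have hle : K0Rels S ≤ H.comap F := by
    refine (AddSubgroup.closure_le _).2 ?_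
    rintro _ (⟨M, A, B, hM, rfl⟩ | ⟨P, hP, rfl⟩)
    · refine ⟨0, zero_mem _, 0, zero_mem _, ?_⟩
      have : ι (cls M) = ι (cls A) + ι (cls B) := by rw [cls_eq_add.2 hM, map_add]
      simp [F, this]
    · exact ⟨cls P, ⟨P, hP, rfl⟩, 0, zero_mem _, by simp [F]⟩
  obtain ⟨M, rfl⟩ := exists_cls x
  obtain ⟨N, rfl⟩ := exists_cls y
  have hmem : FreeAbelianGroup.of M - FreeAbelianGroup.of N ∈ K0Rels S := by
    rw [← QuotientAddGroup.eq_zero_iff, QuotientAddGroup.mk_sub, sub_eq_zero]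
    exact h
  obtain ⟨p, hp, q, hq, hpq⟩ := hle hmem
  refine ⟨q, hq, p, hp, GrothendieckAddGroup.of_injective ?_⟩
  change ι (cls M + q) = ι (cls N + p)
  rw [map_sub, FreeAbelianGroup.lift_apply_of, FreeAbelianGroup.lift_apply_of] at hpq
  rw [map_add, map_add, add_comm (ι (cls N)), ← sub_eq_sub_iff_add_eq_add]
  exact hpq

theorem stab_iff [IsArtinianRing S] {M N : FGMod S} : Stab (cls M) (cls N) ↔ toK0 M = toK0 N :=
  ⟨fun h => k0_eq_of_stab h, fun h => stab_of_k0_eq h⟩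

theorem isProj_of_toK0_eq_zero [IsArtinianRing S] {M : FGMod S} (h : toK0 M = 0) : M.IsProj := by
  obtain ⟨p, hp, q, hq, hpq⟩ := stab_iff.2 (h.trans toK0_zeroMod.symm)
  rw [cls_zeroMod, zero_add] at hpq
  rw [← hpq] at hq
  obtain ⟨Q, hQ, hQ'⟩ := hq
  exact hQ.of_isSummand (isSummand_iff.2 ⟨p, hQ'⟩)

theorem Indec.isProj_or_summand [IsArtinianRing S] {N A B : FGMod S} (hN : Indec N)
    (h : toK0 A = toK0 B) (hA : IsSummand N A) : N.IsProj ∨ IsSummand N B := by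
  obtain ⟨p, hp, _, ⟨Q, hQ, rfl⟩, hpq⟩ := stab_iff.2 h
  obtain ⟨x, hx⟩ := isSummand_iff.1 hA
  rw [hx, add_assoc] at hpq
  exact (hN.summand_or hpq).symm.imp_left hQ.of_isSummand

/-! ### Closure properties of `add C` -/

theorem mem_addOf_of_isSummand {C : Set (FGMod S)} {N M : FGMod S} (hM : M ∈ C)
    (h : IsSummand N M) : N ∈ addOf C := by
  refine ⟨1, fun _ => M, fun _ => hM, ?_⟩
  obtain ⟨x, hx⟩ := isSummand_iff.1 h
  exact isSummand_iff.2 ⟨x, (cls_eq.2 ⟨LinearEquiv.funUnique (Fin 1) S M.carrier⟩).trans hx⟩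

theorem zeroMod_mem_addOf (C : Set (FGMod S)) : zeroMod S ∈ addOf C := by
  refine ⟨0, Fin.elim0, fun i => i.elim0, isSummand_iff.2 ⟨0, ?_⟩⟩
  rw [cls_zeroMod, zero_add]
  exact cls_eq_zero (inferInstanceAs (Subsingleton (∀ i : Fin 0, _)))

theorem prodMod_mem_addOf {C : Set (FGMod S)} {A B : FGMod S} (hA : A ∈ C) (hB : B ∈ C) :
    prodMod A B ∈ addOf C := by
  refine ⟨2, ![A, B], fun i => ?_, isSummand_iff.2 ⟨0, ?_⟩⟩
  · fin_cases i <;> assumption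
  · rw [add_zero]
    exact cls_eq.2 ⟨LinearEquiv.piFinTwo S fun i => (![A, B] i).carrier⟩

theorem exists_sub_of_mem_grpOf {D : Set (FGMod S)} (hD : D = addOf D) {z : K0 S}
    (hz : z ∈ grpOf D) : ∃ A ∈ D, ∃ B ∈ D, z = toK0 A - toK0 B := by
  have h0 : zeroMod S ∈ D := hD ▸ zeroMod_mem_addOf D
  have hprod : ∀ A ∈ D, ∀ B ∈ D, prodMod A B ∈ D := fun A hA B hB =>
    hD ▸ prodMod_mem_addOf hA hB
  induction hz using AddSubgroup.closure_induction with
  | mem x h =>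
    obtain ⟨N, M, hM, hN, rfl⟩ := h
    exact ⟨N, hD ▸ mem_addOf_of_isSummand hM hN, zeroMod S, h0, by rw [toK0_zeroMod, sub_zero]⟩
  | zero => exact ⟨_, h0, _, h0, (sub_self _).symm⟩
  | add x y _ _ hx hy =>
    obtain ⟨A, hA, B, hB, rfl⟩ := hx
    obtain ⟨A', hA', B', hB', rfl⟩ := hy
    refine ⟨_, hprod A hA A' hA', _, hprod B hB B' hB', ?_⟩
    rw [toK0_prodMod, toK0_prodMod]
    abel
  | neg x _ hx =>
    obtain ⟨A, hA, B, hB, rfl⟩ := hx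
    exact ⟨B, hB, A, hA, neg_sub _ _⟩

theorem toK0_mem_grpOf {C : Set (FGMod S)} {N M : FGMod S} (hM : M ∈ C) (h : IsSummand N M) :
    toK0 N ∈ grpOf C :=
  AddSubgroup.subset_closure ⟨N, M, hM, h, rfl⟩

section Artinian

variable [IsArtinianRing S]

theorem toK0_mem_grpOf_of_mem_addOf {C : Set (FGMod S)} {N : FGMod S} (h : N ∈ addOf C) :
    toK0 N ∈ grpOf C := by
  obtain ⟨k, f, hf, h⟩ := h
  refine indec_induction (P := fun x => k0 x ∈ grpOf C) ?_ ?_ N ?_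
  · rw [map_zero]
    exact zero_mem _
  · intro x y hx hy
    rw [map_add]
    exact add_mem hx hy
  · intro N' hN' hs
    obtain ⟨i, hi⟩ := hN'.exists_of_isSummand_dsum (hs.trans h)
    exact toK0_mem_grpOf (hf i) hi

theorem exists_finite_grpOf_le (M : FGMod S) :
    ∃ T : Set (K0 S), T.Finite ∧ grpOf {M} ≤ AddSubgroup.closure T := by
  obtain ⟨l, hl⟩ := exists_indec_list M
  refine ⟨k0 '' {x | x ∈ l}, l.finite_toSet.image _, (AddSubgroup.closure_le _).2 ?_⟩
  rintro _ ⟨N, _, rfl, hN, rfl⟩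
  refine indec_induction (P := fun x => k0 x ∈ AddSubgroup.closure (k0 '' {x | x ∈ l})) ?_ ?_ N ?_
  · rw [map_zero]
    exact zero_mem _
  · intro x y hx hy
    rw [map_add]
    exact add_mem hx hy
  · intro N' hN' hs
    exact AddSubgroup.subset_closure ⟨_, hl N' hN' (hs.trans hN), rfl⟩

end Artinian

end FGMod

/-! ### The `η` invariant -/

/-- Fitting's lemma for subgroups of finitely generated abelian groups. -/
theorem eta_spec {G : Type v} [AddCommGroup G] (L : AddMonoid.End G) {X : AddSubgroup G}
    {T : Set G} (hT : T.Finite) (hX : X ≤ AddSubgroup.closure T) :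
    ∀ m, eta L X ≤ m → Set.InjOn L (X.map (L ^ m) : Set G) := by
  refine Nat.sInf_mem (s := {k : ℕ | ∀ m : ℕ, k ≤ m → Set.InjOn L (X.map (L ^ m) : Set G)}) ?_
  have hspan : Module.Finite ℤ (Submodule.span ℤ T) := Module.Finite.span_of_finite ℤ hT
  have hnoe : IsNoetherian ℤ (AddSubgroup.toIntSubmodule X) := by
    refine isNoetherian_of_le (t := Submodule.span ℤ T) fun x hx => ?_
    have := hX hx
    rwa [← Submodule.span_int_eq_addSubgroupClosure] at this
  let K : ℕ →o Submodule ℤ (AddSubgroup.toIntSubmodule X) :=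
    { toFun := fun k => LinearMap.ker ((L ^ k).toIntLinearMap ∘ₗ Submodule.subtype _)
      monotone' := by
        intro a b hab x hx
        obtain ⟨c, rfl⟩ := Nat.exists_eq_add_of_le hab
        replace hx : (L ^ a) x.1 = 0 := hx
        change (L ^ (a + c)) x.1 = 0
        rw [add_comm, pow_add, AddMonoid.End.coe_mul, Function.comp_apply, hx, map_zero] }
  obtain ⟨n, hn⟩ := monotone_stabilizes_iff_noetherian.2 hnoe K
  refine ⟨n, fun m hm => ?_⟩
  rintro _ ⟨a, ha, rfl⟩ _ ⟨b, hb, rfl⟩ hab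
  have hmem : (⟨a - b, sub_mem ha hb⟩ : AddSubgroup.toIntSubmodule X) ∈ K (m + 1) := by
    change (L ^ (m + 1)) (a - b) = 0
    rw [pow_succ', AddMonoid.End.coe_mul, Function.comp_apply, map_sub, map_sub, sub_eq_zero]
    exact hab
  rw [← hn _ (by omega : n ≤ m + 1), hn _ hm] at hmem
  have : (L ^ m) (a - b) = 0 := hmem
  rwa [map_sub, sub_eq_zero] at this

theorem pow_eta_eq_zero {G : Type v} [AddCommGroup G] (L : AddMonoid.End G) {X : AddSubgroup G}
    {T : Set G} (hT : T.Finite) (hX : X ≤ AddSubgroup.closure T) {x : G} (hx : x ∈ X) {k : ℕ}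
    (h : (L ^ k) x = 0) : (L ^ eta L X) x = 0 := by
  have step : ∀ j, (L ^ (eta L X + j)) x = 0 → (L ^ eta L X) x = 0 := by
    intro j
    induction j with
    | zero => exact id
    | succ j ih =>
      intro hj
      rw [← add_assoc, pow_succ', AddMonoid.End.coe_mul, Function.comp_apply] at hj
      refine ih (eta_spec L hT hX _ (Nat.le_add_right _ j) ⟨x, hx, rfl⟩
        ⟨0, zero_mem _, map_zero _⟩ (hj.trans (map_zero L).symm))
  refine step k ?_
  rw [pow_add, AddMonoid.End.coe_mul, Function.comp_apply, h, map_zero]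

theorem IsSyzEnd.pow_toK0 {L : AddMonoid.End (K0 S)} (hL : IsSyzEnd L) (k : ℕ) (M : FGMod S) :
    (L ^ k) (toK0 M) = toK0 (syz^[k] M) := by
  induction k with
  | zero => rfl
  | succ k ih =>
    rw [pow_succ', AddMonoid.End.coe_mul, Function.comp_apply, ih, hL,
      Function.iterate_succ_apply']

theorem IsSyzEndD.pow_mk {D : Set (FGMod S)} {L : AddMonoid.End (K0 S)} (hL : IsSyzEnd L)
    {LD : AddMonoid.End (KD D)} (hLD : IsSyzEndD D LD) (k : ℕ) (z : K0 S) :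
    (LD ^ k) (QuotientAddGroup.mk' (grpOf D) z) = QuotientAddGroup.mk' (grpOf D) ((L ^ k) z) := by
  have h1 : ∀ z, LD (QuotientAddGroup.mk' (grpOf D) z) = QuotientAddGroup.mk' (grpOf D) (L z) := by
    intro z
    have : (AddMonoidHom.comp LD (QuotientAddGroup.mk' (grpOf D))) =
        (QuotientAddGroup.mk' (grpOf D)).comp L := by
      refine QuotientAddGroup.addMonoidHom_ext _ (FreeAbelianGroup.lift_ext _ _ fun M => ?_)
      change LD (toKD D M) = QuotientAddGroup.mk' (grpOf D) (L (toK0 M))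
      rw [hLD, hL]
      rfl
    exact DFunLike.congr_fun this z
  induction k with
  | zero => rfl
  | succ k ih =>
    rw [pow_succ', AddMonoid.End.coe_mul, Function.comp_apply, ih, h1, pow_succ',
      AddMonoid.End.coe_mul, Function.comp_apply]

/-- On a `0`-Igusa–Todorov subcategory the syzygy operator is injective. -/
theorem IsZeroIT.eq_zero_of_pow_eq_zero [IsArtinianRing S] {L : AddMonoid.End (K0 S)}
    {D : Set (FGMod S)} (hD : IsZeroIT L D) {z : K0 S} (hz : z ∈ grpOf D) {k : ℕ}
    (h : (L ^ k) z = 0) : z = 0 := by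
  obtain ⟨A, hA, B, hB, rfl⟩ := exists_sub_of_mem_grpOf hD.1 hz
  have hAB : prodMod A B ∈ D := hD.1 ▸ prodMod_mem_addOf hA hB
  obtain ⟨T, hT, hle⟩ := exists_finite_grpOf_le (prodMod A B)
  have hphi : eta L (grpOf {prodMod A B}) = 0 := by
    have := hD.2.2
    simp only [phidim, ENat.iSup_eq_zero] at this
    exact_mod_cast this _ hAB
  have hmem : toK0 A - toK0 B ∈ grpOf {prodMod A B} :=
    sub_mem (toK0_mem_grpOf rfl (isSummand_iff.2 ⟨cls B, rfl⟩))
      (toK0_mem_grpOf rfl (isSummand_iff.2 ⟨cls A, add_comm (cls A) (cls B)⟩))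
  have := pow_eta_eq_zero L hT hle hmem h
  rwa [hphi] at this

namespace FGMod

/-! ### Projective covers and syzygies -/

theorem IsProj.prodMod {P Q : FGMod S} (hP : P.IsProj) (hQ : Q.IsProj) : (prodMod P Q).IsProj :=
  cls_mem_projCls.1 (add_mem (cls_mem_projCls.2 hP) (cls_mem_projCls.2 hQ))

theorem isProj_zeroMod : (zeroMod S).IsProj := cls_mem_projCls.1 (zero_mem _)

section Artinian

variable [IsArtinianRing S]

theorem exists_isProjCover (M : FGMod S) :
    ∃ (P : FGMod S) (f : P.carrier →ₗ[S] M.carrier), IsProjCover f := by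
  classical
  have hex : ∃ (k : ℕ) (P : FGMod S) (f : P.carrier →ₗ[S] M.carrier),
      P.IsProj ∧ Surjective f ∧ Module.length S P.carrier = k := by
    obtain ⟨n, f, hf⟩ := Module.Finite.exists_fin' S M.carrier
    obtain ⟨k, hk⟩ := ENat.ne_top_iff_exists.1 (Module.length_ne_top (R := S) (M := Fin n → S))
    exact ⟨k, ⟨Fin n → S⟩, f, inferInstanceAs (Module.Projective S (Fin n → S)), hf, hk.symm⟩
  obtain ⟨P, f, hP, hf, hlen⟩ := Nat.find_spec hex
  have hmin := fun m => Nat.find_min' hex (m := m)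
  refine ⟨P, f, hP, hf, fun N hN => ?_⟩
  have hPp : Module.Projective S P.carrier := hP
  have hsurj : Surjective (f ∘ₗ N.subtype) := by
    intro m
    obtain ⟨p, rfl⟩ := hf m
    obtain ⟨y, hy, z, hz, rfl⟩ := Submodule.mem_sup.1 (hN ▸ Submodule.mem_top : p ∈ N ⊔ _)
    exact ⟨⟨y, hy⟩, by simp [LinearMap.mem_ker.1 hz]⟩
  obtain ⟨g, hg⟩ := Module.projective_lifting_property _ f hsurj
  let h : Module.End S P.carrier := N.subtype ∘ₗ g
  have hfh : ∀ (k : ℕ) (x : P.carrier), f ((h ^ k) x) = f x := by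
    intro k
    induction k with
    | zero => exact fun x => rfl
    | succ k ih =>
      intro x
      rw [pow_succ, Module.End.mul_apply, ih]
      exact LinearMap.congr_fun hg x
  obtain ⟨k, hk, hk0⟩ := (h.eventually_isCompl_ker_pow_range_pow.and
    (Filter.eventually_ge_atTop 1)).exists
  have hQ : IsSummand ⟨LinearMap.range (h ^ k)⟩ P :=
    ⟨⟨LinearMap.ker (h ^ k)⟩, ⟨(Submodule.prodEquivOfIsCompl _ _ hk.symm).symm⟩⟩
  have htop : LinearMap.range (h ^ k) = ⊤ := by
    by_contra hne
    have hlt := Submodule.length_lt hne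
    obtain ⟨j, hj⟩ := ENat.ne_top_iff_exists.1
      (Module.length_ne_top (R := S) (M := LinearMap.range (h ^ k)))
    have := hmin j ⟨⟨LinearMap.range (h ^ k)⟩, f ∘ₗ Submodule.subtype _, hP.of_isSummand hQ,
      fun m => by
        obtain ⟨p, rfl⟩ := hf m
        exact ⟨⟨(h ^ k) p, p, rfl⟩, hfh k p⟩, hj.symm⟩
    rw [hlen, ← hj] at hlt
    norm_cast at hlt
    omega
  refine top_le_iff.1 (htop ▸ ?_)
  rintro _ ⟨x, rfl⟩
  obtain ⟨j, rfl⟩ := Nat.exists_eq_add_of_le' hk0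
  rw [pow_succ', Module.End.mul_apply]
  exact (g _).2

theorem isSyzygyOf_syz (M : FGMod S) : IsSyzygyOf (syz M) M := by
  have h : ∃ N, IsSyzygyOf N M := by
    obtain ⟨P, f, hf⟩ := exists_isProjCover M
    exact ⟨⟨LinearMap.ker f⟩, P, f, hf, ⟨.refl _ _⟩⟩
  rw [syz, dif_pos h]
  exact h.choose_spec

theorem exists_ses_syz (M : FGMod S) : ∃ P : FGMod S, P.IsProj ∧ SES (syz M) P M := by
  obtain ⟨P, f, ⟨hP, hf, -⟩, ⟨e⟩⟩ := isSyzygyOf_syz M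
  refine ⟨P, hP, (LinearMap.ker f).subtype ∘ₗ e.toLinearMap, f, ?_, hf, ?_⟩
  · exact (Submodule.subtype_injective _).comp e.injective
  · rw [LinearMap.range_comp, LinearEquiv.range, Submodule.map_top, Submodule.range_subtype]

end Artinian

/-! ### Short exact sequences -/

theorem SES.congr {X Y Z X' Y' Z' : FGMod S} (h : SES X Y Z) (hX : cls X = cls X')
    (hY : cls Y = cls Y') (hZ : cls Z = cls Z') : SES X' Y' Z' := by
  obtain ⟨f, g, hf, hg, hfg⟩ := h
  obtain ⟨a⟩ := cls_eq.1 hX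
  obtain ⟨b⟩ := cls_eq.1 hY
  obtain ⟨c⟩ := cls_eq.1 hZ
  refine ⟨b.toLinearMap ∘ₗ f ∘ₗ a.symm.toLinearMap, c.toLinearMap ∘ₗ g ∘ₗ b.symm.toLinearMap,
    b.injective.comp (hf.comp a.symm.injective), c.surjective.comp (hg.comp b.symm.surjective), ?_⟩
  rw [← LinearMap.exact_iff.trans eq_comm] at hfg ⊢
  intro y
  have := hfg (b.symm y)
  simp only [LinearMap.comp_apply, LinearEquiv.coe_coe, c.map_eq_zero_iff, Set.mem_range] at this ⊢
  rw [this]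
  constructor
  · rintro ⟨x, hx⟩
    exact ⟨a x, by simp [hx]⟩
  · rintro ⟨x, hx⟩
    exact ⟨a.symm x, by simp [← hx]⟩

theorem SES.prod_right {X Y Z : FGMod S} (h : SES X Y Z) (R : FGMod S) :
    SES X (prodMod Y R) (prodMod Z R) := by
  obtain ⟨f, g, hf, hg, hfg⟩ := h
  refine ⟨LinearMap.inl S Y.carrier R.carrier ∘ₗ f, g.prodMap (LinearMap.id (M := R.carrier)),
    LinearMap.inl_injective.comp hf, Prod.map_surjective.2 ⟨hg, surjective_id⟩, ?_⟩
  ext ⟨y, r⟩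
  constructor
  · rintro ⟨x, h⟩
    obtain ⟨rfl, rfl⟩ := Prod.ext_iff.1 h
    exact Prod.ext (LinearMap.mem_ker.1 (hfg ▸ ⟨x, rfl⟩ : f x ∈ LinearMap.ker g)) rfl
  · intro h
    obtain ⟨h1, h2⟩ := Prod.ext_iff.1 h
    obtain ⟨x, hx⟩ : y ∈ LinearMap.range f := hfg ▸ LinearMap.mem_ker.2 h1
    exact ⟨x, Prod.ext hx h2.symm⟩

theorem SES.prod_left {X Y Z : FGMod S} (h : SES X Y Z) (R : FGMod S) :
    SES (prodMod X R) (prodMod Y R) Z := by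
  obtain ⟨f, g, hf, hg, hfg⟩ := h
  refine ⟨f.prodMap (LinearMap.id (M := R.carrier)), g ∘ₗ LinearMap.fst S Y.carrier R.carrier,
    Prod.map_injective.2 ⟨hf, injective_id⟩, hg.comp Prod.fst_surjective, ?_⟩
  ext ⟨y, r⟩
  constructor
  · rintro ⟨⟨x, r'⟩, h⟩
    obtain ⟨rfl, rfl⟩ := Prod.ext_iff.1 h
    exact LinearMap.mem_ker.1 (hfg ▸ ⟨x, rfl⟩ : f x ∈ LinearMap.ker g)
  · intro h
    obtain ⟨x, hx⟩ : y ∈ LinearMap.range f := hfg ▸ LinearMap.mem_ker.2 h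
    exact ⟨(x, r), Prod.ext hx rfl⟩

/-- Rotation of a short exact sequence along a presentation of its cokernel. -/
theorem SES.rotate {X Y Z K Q : FGMod S} (h : SES X Y Z) (hQ : Q.IsProj) (hK : SES K Q Z) :
    SES K (prodMod X Q) Y := by
  obtain ⟨f, g, hf, hg, hfg⟩ := h
  obtain ⟨i, p, hi, hp, hip⟩ := hK
  have hQ' : Module.Projective S Q.carrier := hQ
  obtain ⟨l, hl⟩ := Module.projective_lifting_property g p hg
  replace hl : ∀ q, g (l q) = p q := fun q => LinearMap.congr_fun hl q
  have hpi : ∀ k, p (i k) = 0 := fun k => LinearMap.mem_ker.1 (hip ▸ ⟨k, rfl⟩)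
  have hgf : ∀ x, g (f x) = 0 := fun x => LinearMap.mem_ker.1 (hfg ▸ ⟨x, rfl⟩)
  let e := LinearEquiv.ofInjective f hf
  let m : K.carrier →ₗ[S] X.carrier := e.symm.toLinearMap ∘ₗ
    (l ∘ₗ i).codRestrict (LinearMap.range f) fun k => by
      rw [hfg, LinearMap.mem_ker, LinearMap.comp_apply, hl, hpi]
  have hm : ∀ k, f (m k) = l (i k) := fun k =>
    congrArg Subtype.val (e.apply_symm_apply ⟨l (i k), _⟩)
  refine ⟨(-m).prod i, f.coprod l, ?_, ?_, ?_⟩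
  · exact fun a b hab => hi (Prod.ext_iff.1 hab).2
  · intro y
    obtain ⟨q, hq⟩ := hp (g y)
    obtain ⟨x, hx⟩ : y - l q ∈ LinearMap.range f := by
      rw [hfg, LinearMap.mem_ker, map_sub, hl, hq, sub_self]
    exact ⟨(x, q), by change f x + l q = y; rw [hx, sub_add_cancel]⟩
  · ext ⟨x, q⟩
    constructor
    · rintro ⟨k, hk⟩
      obtain ⟨rfl, rfl⟩ := Prod.ext_iff.1 hk
      change f (-m k) + l (i k) = 0
      rw [map_neg, hm, neg_add_cancel]
    · intro h
      replace h : f x + l q = 0 := h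
      obtain ⟨k, rfl⟩ : q ∈ LinearMap.range i := by
        have := congrArg g h
        rw [hip, LinearMap.mem_ker, ← hl]
        simpa [hgf] using this
      refine ⟨k, Prod.ext (hf ?_) rfl⟩
      change f (-m k) = f x
      rw [map_neg, hm]
      exact (eq_neg_of_add_eq_zero_left h).symm

theorem SES.cls_eq_add {X Y Z : FGMod S} (h : SES X Y Z) (hZ : Z.IsProj) :
    cls Y = cls X + cls Z := by
  obtain ⟨f, g, hf, hg, hfg⟩ := h
  have hZ' : Module.Projective S Z.carrier := hZ
  obtain ⟨s, hs⟩ := Module.projective_lifting_property g LinearMap.id hg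
  replace hs : ∀ z, g (s z) = z := fun z => LinearMap.congr_fun hs z
  have hgf : ∀ x, g (f x) = 0 := fun x => LinearMap.mem_ker.1 (hfg ▸ ⟨x, rfl⟩)
  refine FGMod.cls_eq_add.2 ⟨(LinearEquiv.ofBijective (f.coprod s) ⟨?_, ?_⟩).symm⟩
  · refine (injective_iff_map_eq_zero _).2 ?_
    rintro ⟨x, z⟩ h
    rw [LinearMap.coprod_apply] at h
    have hz : z = 0 := by simpa [hgf, hs] using congrArg g h
    subst hz
    replace h : f x = 0 := by simpa using h
    exact Prod.ext ((map_eq_zero_iff f hf).1 h) rfl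
  · intro y
    obtain ⟨x, hx⟩ : y - s (g y) ∈ LinearMap.range f := by
      rw [hfg, LinearMap.mem_ker, map_sub, hs, sub_self]
    exact ⟨(x, g y), by rw [LinearMap.coprod_apply, hx, sub_add_cancel]⟩

/-- Short exact sequences up to projective summands. -/
def StSES (X Y Z : FGMod S) : Prop :=
  ∃ P Q R : FGMod S, P.IsProj ∧ Q.IsProj ∧ R.IsProj ∧
    SES (prodMod X P) (prodMod Y Q) (prodMod Z R)

theorem SES.stSES {X Y Z : FGMod S} (h : SES X Y Z) : StSES X Y Z :=
  ⟨zeroMod S, zeroMod S, zeroMod S, isProj_zeroMod, isProj_zeroMod, isProj_zeroMod,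
    h.congr (add_zero _).symm (add_zero _).symm (add_zero _).symm⟩

theorem StSES.syz [IsArtinianRing S] {X Y Z : FGMod S} (h : StSES X Y Z) :
    StSES (syz X) (syz Y) (syz Z) := by
  obtain ⟨P, Q, R, hP, hQ, hR, h⟩ := h
  obtain ⟨A, hA, hX⟩ := exists_ses_syz X
  obtain ⟨B, hB, hY⟩ := exists_ses_syz Y
  obtain ⟨C, hC, hZ⟩ := exists_ses_syz Z
  have h1 := h.rotate (hC.prodMod hR) (hZ.prod_right R)
  have h2 := h1.rotate (hB.prodMod hQ) (hY.prod_right Q)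
  have h3 := h2.rotate ((hA.prodMod hP).prodMod (hC.prodMod hR))
    ((hX.prod_right P).prod_right (FGMod.prodMod C R))
  exact ⟨zeroMod S, _, _, isProj_zeroMod, (hA.prodMod hP).prodMod (hC.prodMod hR),
    hB.prodMod hQ, h3.congr (add_zero _).symm rfl rfl⟩

theorem StSES.syz_iterate [IsArtinianRing S] {X Y Z : FGMod S} (h : StSES X Y Z) (k : ℕ) :
    StSES (FGMod.syz^[k] X) (FGMod.syz^[k] Y) (FGMod.syz^[k] Z) := by
  induction k with
  | zero => exact h
  | succ k ih =>
    simp only [Function.iterate_succ_apply']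
    exact ih.syz

theorem StSES.toK0_eq [IsArtinianRing S] {X Y Z : FGMod S} (h : StSES X Y Z) (hZ : Z.IsProj) :
    toK0 X = toK0 Y := by
  obtain ⟨P, Q, R, hP, hQ, hR, h⟩ := h
  have := h.cls_eq_add (hZ.prodMod hR)
  rw [cls_prodMod, cls_prodMod, add_assoc] at this
  exact (stab_iff.1 ⟨_, cls_mem_projCls.2 hQ, _,
    add_mem (cls_mem_projCls.2 hP) (cls_mem_projCls.2 (hZ.prodMod hR)), this⟩).symm

/-- Fitting reduction: a presentation of `Z` by copies of `U` can be cut down to a summand on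
which the induced endomorphism is nilpotent. -/
theorem SES.exists_nilpotent [IsArtinianRing S] {U Q Z : FGMod S} (h : SES U (prodMod U Q) Z) :
    ∃ (W : FGMod S) (a : Module.End S W.carrier) (b : W.carrier →ₗ[S] Q.carrier)
      (g : (prodMod W Q).carrier →ₗ[S] Z.carrier), IsSummand W U ∧ IsNilpotent a ∧
      Injective (a.prod b) ∧ Surjective g ∧ LinearMap.range (a.prod b) = LinearMap.ker g := by
  obtain ⟨f, g, hf, hg, hfg⟩ := h
  let α : Module.End S U.carrier := LinearMap.fst S U.carrier Q.carrier ∘ₗ f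
  let β : U.carrier →ₗ[S] Q.carrier := LinearMap.snd S U.carrier Q.carrier ∘ₗ f
  have hgf : ∀ x, g (f x) = 0 := fun x => LinearMap.mem_ker.1 (hfg ▸ ⟨x, rfl⟩)
  obtain ⟨k, hk, hk1⟩ := (α.eventually_isCompl_ker_pow_range_pow.and
    (Filter.eventually_ge_atTop 1)).exists
  obtain ⟨j, rfl⟩ := Nat.exists_eq_add_of_le' hk1
  have hker : ∀ w ∈ LinearMap.ker (α ^ (j + 1)), α w ∈ LinearMap.ker (α ^ (j + 1)) :=
    fun w hw => by
      rw [LinearMap.mem_ker] at hw ⊢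
      rw [← Module.End.mul_apply, ← pow_succ, pow_succ', Module.End.mul_apply, hw, map_zero]
  have hrange : ∀ r ∈ LinearMap.range (α ^ (j + 1)), ∃ r', α r' = r := by
    rintro _ ⟨y, rfl⟩
    exact ⟨(α ^ j) y, by rw [pow_succ', Module.End.mul_apply]⟩
  have hsplit : ∀ y, ∃ w ∈ LinearMap.ker (α ^ (j + 1)), ∃ r', y = w + α r' := fun y => by
    obtain ⟨w, hw, r, hr, h⟩ := Submodule.mem_sup.1 (hk.sup_eq_top ▸ Submodule.mem_top : y ∈ _)
    obtain ⟨r', rfl⟩ := hrange r hr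
    exact ⟨w, hw, r', h.symm⟩
  have hα : ∀ u, α u ∈ LinearMap.ker (α ^ (j + 1)) → u ∈ LinearMap.ker (α ^ (j + 1)) :=
    fun u hu => by
      have h1 : (α ^ (j + 1)) u ∈ LinearMap.ker (α ^ (j + 1)) := by
        rw [LinearMap.mem_ker] at hu ⊢
        rw [← Module.End.mul_apply, ← pow_add, show j + 1 + (j + 1) = j + ((j + 1) + 1) by omega,
          pow_add, Module.End.mul_apply, pow_succ α (j + 1), Module.End.mul_apply, hu, map_zero]
      exact LinearMap.mem_ker.2 ((Submodule.mem_bot S).1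
        (hk.inf_eq_bot ▸ Submodule.mem_inf.2 ⟨h1, _, rfl⟩))
  let a : Module.End S (LinearMap.ker (α ^ (j + 1))) := α.restrict hker
  have ha : ∀ (m : ℕ) w, ((a ^ m) w : U.carrier) = (α ^ m) w := fun m w => by
    rw [Module.End.pow_restrict m hker]
    rfl
  refine ⟨⟨LinearMap.ker (α ^ (j + 1))⟩, a, β ∘ₗ Submodule.subtype _,
    g ∘ₗ (Submodule.subtype _).prodMap LinearMap.id,
    ⟨⟨LinearMap.range (α ^ (j + 1))⟩, ⟨(Submodule.prodEquivOfIsCompl _ _ hk).symm⟩⟩,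
    ⟨j + 1, ?_⟩, ?_, ?_, ?_⟩
  · ext w
    exact (ha _ w).trans w.2
  · intro w w' h
    obtain ⟨h1, h2⟩ := Prod.ext_iff.1 h
    exact Subtype.ext (hf (Prod.ext (congrArg Subtype.val h1) h2))
  · intro z
    obtain ⟨⟨u, q⟩, rfl⟩ := hg z
    obtain ⟨w, hw, r, rfl⟩ := hsplit u
    obtain ⟨q, rfl⟩ : ∃ q', q = q' + β r := ⟨q - β r, (sub_add_cancel q (β r)).symm⟩
    exact ⟨(⟨w, hw⟩, q), (add_zero _).symm.trans
      ((congrArg (g (w, q) + ·) (hgf r).symm).trans (map_add g (w, q) (f r)).symm)⟩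
  · ext ⟨w, q⟩
    constructor
    · rintro ⟨w', h⟩
      obtain ⟨rfl, rfl⟩ := Prod.ext_iff.1 h
      exact hgf w'
    · intro h
      obtain ⟨u, hu⟩ : ∃ u, f u = ((w : U.carrier), q) := LinearMap.mem_range.1 <| by
        rw [hfg]
        exact h
      obtain ⟨h1, h2⟩ := Prod.ext_iff.1 hu
      refine ⟨⟨u, hα u ?_⟩, Prod.ext (Subtype.ext h1) h2⟩
      exact (show α u = w from h1) ▸ w.2

end FGMod

/-! ### Projective dimension through `Ext` -/

section ProjectiveDimension

open CategoryTheory Abelian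

theorem shortExact_of_range_eq_ker {X Y Z : Type u} [AddCommGroup X] [Module S X]
    [AddCommGroup Y] [Module S Y] [AddCommGroup Z] [Module S Z] {f : X →ₗ[S] Y} {g : Y →ₗ[S] Z}
    (hf : Injective f) (hg : Surjective g) (hfg : LinearMap.range f = LinearMap.ker g) :
    (ModuleCat.shortComplexOfCompEqZero f g
      (LinearMap.range_le_ker_iff.1 hfg.le)).ShortExact :=
  ModuleCat.shortComplex_shortExact _ (LinearMap.exact_iff.2 hfg.symm) hf hg

/-- If `Z` is presented by a nilpotent endomorphism of `W` and a projective module, then the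
projective dimension of `Z` controls that of `W`. -/
theorem hasProjectiveDimensionLT_of_isNilpotent {W Q Z : Type u} [AddCommGroup W] [Module S W]
    [AddCommGroup Q] [Module S Q] [AddCommGroup Z] [Module S Z] [Module.Projective S Q]
    {a : Module.End S W} {b : W →ₗ[S] Q} {g : W × Q →ₗ[S] Z} (ha : IsNilpotent a)
    (hf : Injective (a.prod b)) (hg : Surjective g)
    (hfg : LinearMap.range (a.prod b) = LinearMap.ker g) {n : ℕ}
    (hZ : HasProjectiveDimensionLT (ModuleCat.of S Z) (n + 2)) :
    HasProjectiveDimensionLT (ModuleCat.of S W) (n + 1) := by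
  have hS := shortExact_of_range_eq_ker hf hg hfg
  have hQ : Projective (ModuleCat.of S Q) := (IsProjective.iff_projective _).1 inferInstance
  rw [hasProjectiveDimensionLT_iff]
  intro i hi Y x
  have hstep : ∀ y : Ext (ModuleCat.of S W) Y i, ∃ y' : Ext (ModuleCat.of S W) Y i,
      (Ext.mk₀ (ModuleCat.ofHom a)).comp y' (zero_add i) = y := by
    intro y
    obtain ⟨z, hz⟩ := Ext.contravariant_sequence_exact₁ hS Y y (add_comm 1 i)
      (Ext.eq_zero_of_hasProjectiveDimensionLT (X := ModuleCat.of S Z) _ (n + 2) (by lia))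
    change Ext (ModuleCat.of S (W × Q)) Y i at z
    change (Ext.mk₀ (ModuleCat.ofHom (a.prod b))).comp z (zero_add i) = y at hz
    refine ⟨(Ext.mk₀ (ModuleCat.ofHom (LinearMap.inl S W Q))).comp z (zero_add i), ?_⟩
    have h0 : (Ext.mk₀ (ModuleCat.ofHom (LinearMap.inr S W Q))).comp z (zero_add i) = 0 :=
      Ext.eq_zero_of_hasProjectiveDimensionLT _ 1 (by lia)
    have hab : ModuleCat.ofHom (a.prod b) =
        ModuleCat.ofHom a ≫ ModuleCat.ofHom (LinearMap.inl S W Q) +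
          ModuleCat.ofHom b ≫ ModuleCat.ofHom (LinearMap.inr S W Q) := by
      ext w <;> simp
    rw [← hz, hab, Ext.mk₀_add, Ext.add_comp, ← Ext.mk₀_comp_mk₀_assoc, ← Ext.mk₀_comp_mk₀_assoc,
      h0, Ext.comp_zero, add_zero]
  have hpow : ∀ k : ℕ, ∃ y : Ext (ModuleCat.of S W) Y i,
      (Ext.mk₀ (ModuleCat.ofHom (a ^ k))).comp y (zero_add i) = x := by
    intro k
    induction k with
    | zero => exact ⟨x, Ext.mk₀_id_comp x⟩
    | succ k ih =>
      obtain ⟨y, rfl⟩ := ih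
      obtain ⟨y', rfl⟩ := hstep y
      exact ⟨y', by rw [Ext.mk₀_comp_mk₀_assoc, ← ModuleCat.ofHom_comp, pow_succ']⟩
  obtain ⟨k, hk⟩ := ha
  obtain ⟨y, rfl⟩ := hpow k
  rw [hk, ModuleCat.ofHom_zero, Ext.mk₀_zero, Ext.zero_comp]

namespace FGMod

/-- The projective dimension of `M` is less than `n`. -/
def PdLT (M : FGMod S) (n : ℕ) : Prop :=
  HasProjectiveDimensionLT (ModuleCat.of S M.carrier) n

theorem pdLT_one_iff {M : FGMod S} : PdLT M 1 ↔ M.IsProj :=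
  projective_iff_hasProjectiveDimensionLT_one.symm.trans (IsProjective.iff_projective _).symm

theorem PdLT.mono {M : FGMod S} {m n : ℕ} (h : PdLT M m) (hmn : m ≤ n) : PdLT M n :=
  have : HasProjectiveDimensionLT (ModuleCat.of S M.carrier) m := h
  hasProjectiveDimensionLT_of_ge _ m n hmn

theorem IsSummand.pdLT {N M : FGMod S} {n : ℕ} (h : IsSummand N M) (hM : PdLT M n) :
    PdLT N n := by
  obtain ⟨N', ⟨e⟩⟩ := h
  have : HasProjectiveDimensionLT (ModuleCat.of S M.carrier) n := hM
  let r : Retract (ModuleCat.of S N.carrier) (ModuleCat.of S M.carrier) :=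
    { i := ModuleCat.ofHom (e.symm.toLinearMap ∘ₗ LinearMap.inl S _ _)
      r := ModuleCat.ofHom (LinearMap.fst S _ _ ∘ₗ e.toLinearMap)
      retract := by ext x; simp }
  exact r.hasProjectiveDimensionLT n

theorem pdLT_congr {M N : FGMod S} (h : cls M = cls N) {n : ℕ} : PdLT M n ↔ PdLT N n :=
  ⟨fun hM => IsSummand.pdLT (isSummand_iff.2 ⟨0, by rw [h, add_zero]⟩) hM,
    fun hN => IsSummand.pdLT (isSummand_iff.2 ⟨0, by rw [h, add_zero]⟩) hN⟩

theorem SES.pdLT_middle {X Y Z : FGMod S} (h : SES X Y Z) {n : ℕ} (hX : PdLT X n)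
    (hZ : PdLT Z n) : PdLT Y n := by
  obtain ⟨f, g, hf, hg, hfg⟩ := h
  exact (shortExact_of_range_eq_ker hf hg hfg).hasProjectiveDimensionLT_X₂ n hX hZ

theorem SES.pdLT_right {X Y Z : FGMod S} (h : SES X Y Z) {n : ℕ} (hX : PdLT X n)
    (hY : PdLT Y (n + 1)) : PdLT Z (n + 1) := by
  obtain ⟨f, g, hf, hg, hfg⟩ := h
  exact (shortExact_of_range_eq_ker hf hg hfg).hasProjectiveDimensionLT_X₃ n hX hY

theorem SES.pdLT_right_iff {X Y Z : FGMod S} (h : SES X Y Z) (hY : Y.IsProj) {n : ℕ} :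
    PdLT Z (n + 2) ↔ PdLT X (n + 1) := by
  obtain ⟨f, g, hf, hg, hfg⟩ := h
  exact (shortExact_of_range_eq_ker hf hg hfg).hasProjectiveDimensionLT_X₃_iff n
    ((IsProjective.iff_projective _).1 hY)

theorem PdLT.prodMod {M N : FGMod S} {n : ℕ} (hM : PdLT M n) (hN : PdLT N n) :
    PdLT (prodMod M N) n :=
  SES.pdLT_middle ⟨LinearMap.inl S M.carrier N.carrier, LinearMap.snd S M.carrier N.carrier,
    LinearMap.inl_injective, Prod.snd_surjective, LinearMap.range_inl ..⟩ hM hN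

theorem IsProj.pdLT {P : FGMod S} (hP : P.IsProj) (n : ℕ) : PdLT P (n + 1) :=
  (pdLT_one_iff.2 hP).mono (Nat.le_add_left 1 n)

section Artinian

variable [IsArtinianRing S]

theorem pdLT_iterate_syz {M : FGMod S} {j : ℕ} (k : ℕ) :
    PdLT (syz^[k] M) (j + 1) ↔ PdLT M (k + j + 1) := by
  induction k generalizing j with
  | zero => rw [Nat.zero_add]; rfl
  | succ k ih =>
    obtain ⟨P, hP, h⟩ := exists_ses_syz (syz^[k] M)
    rw [Function.iterate_succ_apply', ← h.pdLT_right_iff hP, ih]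
    lia

theorem pdim_le_iff {M : FGMod S} {k : ℕ} : pdim M ≤ k ↔ PdLT M (k + 1) := by
  have hiff : ∀ k, (syz^[k] M).IsProj ↔ PdLT M (k + 1) := fun k => by
    rw [← pdLT_one_iff, pdLT_iterate_syz (j := 0) k, Nat.add_zero]
  constructor
  · intro h
    have hne : ((↑) '' {n : ℕ | (syz^[n] M).IsProj} : Set ℕ∞).Nonempty := by
      rw [Set.nonempty_iff_ne_empty]
      intro h0
      rw [pdim, h0, sInf_empty] at h
      exact ENat.natCast_ne_top k (top_le_iff.1 h)
    obtain ⟨m, hm, hmk⟩ := csInf_mem hne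
    have : (m : ℕ∞) ≤ k := hmk.trans_le h
    exact ((hiff m).1 hm).mono (by norm_cast at this; lia)
  · exact fun h => sInf_le ⟨k, (hiff k).2 h, rfl⟩

theorem pdim_ne_top_iff {M : FGMod S} : pdim M ≠ ⊤ ↔ ∃ k, PdLT M (k + 1) := by
  rw [ENat.ne_top_iff_exists]
  constructor
  · rintro ⟨k, hk⟩
    exact ⟨k, pdim_le_iff.1 hk.ge⟩
  · rintro ⟨k, hk⟩
    obtain ⟨j, hj⟩ := ENat.ne_top_iff_exists.1
      ((pdim_le_iff.2 hk).trans_lt (ENat.natCast_lt_top k)).ne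
    exact ⟨j, hj⟩

end Artinian

end FGMod

end ProjectiveDimension

section Artinian

variable [IsArtinianRing S]

namespace FGMod

theorem pdLT_of_indec {M : FGMod S} {b : ℕ}
    (h : ∀ N, Indec N → IsSummand N M → PdLT N (b + 1)) : PdLT M (b + 1) := by
  refine indec_induction (P := fun x => ∀ N, cls N = x → PdLT N (b + 1)) ?_ ?_ M ?_ M rfl
  · exact fun N hN => (pdLT_congr (hN.trans cls_zeroMod.symm)).2 (isProj_zeroMod.pdLT b)
  · intro x y hx hy N hN
    obtain ⟨A, rfl⟩ := exists_cls x
    obtain ⟨B, rfl⟩ := exists_cls y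
    exact (pdLT_congr (N := prodMod A B) hN).2 ((hx A rfl).prodMod (hy B rfl))
  · exact fun N hN hNM N' h' => (pdLT_congr h').2 (h N hN hNM)

/-- The modules of finite projective dimension in `add M` have bounded projective dimension. -/
theorem exists_pdLT_bound (M : FGMod S) :
    ∃ b : ℕ, ∀ N ∈ addOf {M}, ∀ k, PdLT N (k + 1) → PdLT N (b + 1) := by
  obtain ⟨l, hl⟩ := exists_indec_list M
  have hlist : ∀ l : List (IsoClass S), ∃ b : ℕ, ∀ N, cls N ∈ l →
      ∀ k, PdLT N (k + 1) → PdLT N (b + 1) := by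
    intro l
    induction l with
    | nil => exact ⟨0, fun N hN => absurd hN List.not_mem_nil⟩
    | cons x l ih =>
      obtain ⟨b, hb⟩ := ih
      obtain ⟨X, rfl⟩ := exists_cls x
      by_cases hX : ∃ c, PdLT X (c + 1)
      · obtain ⟨c, hc⟩ := hX
        refine ⟨max b c, fun N hN k hk => ?_⟩
        rcases List.mem_cons.1 hN with h | h
        · exact ((pdLT_congr h).2 hc).mono (by lia)
        · exact (hb N h k hk).mono (by lia)
      · refine ⟨b, fun N hN k hk => ?_⟩
        rcases List.mem_cons.1 hN with h | h
        · exact absurd ⟨k, (pdLT_congr h).1 hk⟩ hX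
        · exact hb N h k hk
  obtain ⟨b, hb⟩ := hlist l
  refine ⟨b, fun N hN k hk => pdLT_of_indec fun N' hN' hs => hb N' ?_ k (hs.pdLT hk)⟩
  obtain ⟨j, f, hf, h⟩ := hN
  obtain ⟨i, hi⟩ := hN'.exists_of_isSummand_dsum (hs.trans h)
  exact hl N' hN' (hf i ▸ hi)

end FGMod

theorem findim_addOf_singleton_lt_top (M : FGMod S) : findim (addOf {M}) < ⊤ := by
  obtain ⟨b, hb⟩ := exists_pdLT_bound M
  refine lt_of_le_of_lt (iSup₂_le fun N hN => ?_) (ENat.natCast_lt_top b)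
  obtain ⟨k, hk⟩ := pdim_ne_top_iff.1 hN.2
  exact pdim_le_iff.2 (hb N hN.1 k hk)

namespace FGMod

theorem Indec.isProj_or_summand_iterate_syz_of_add {L : AddMonoid.End (K0 S)} (hL : IsSyzEnd L)
    {N M A B : FGMod S} (hN : Indec N) (hM : cls M = cls A + cls B) {k : ℕ}
    (h : IsSummand N (syz^[k] M)) :
    N.IsProj ∨ IsSummand N (syz^[k] A) ∨ IsSummand N (syz^[k] B) := by
  have hK : toK0 (syz^[k] M) = toK0 (prodMod (syz^[k] A) (syz^[k] B)) := by
    rw [toK0_prodMod, ← hL.pow_toK0, ← hL.pow_toK0, ← hL.pow_toK0, toK0_of_cls_eq_add hM, map_add]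
  refine (hN.isProj_or_summand hK h).imp_right fun h' => ?_
  obtain ⟨x, hx⟩ := isSummand_iff.1 h'
  exact hN.summand_or hx.symm

theorem Indec.isProj_or_summand_iterate_syz {L : AddMonoid.End (K0 S)} (hL : IsSyzEnd L)
    {N V M : FGMod S} (hN : Indec N) (hM : M ∈ addOf {V}) {k : ℕ}
    (h : IsSummand N (syz^[k] M)) : N.IsProj ∨ IsSummand N (syz^[k] V) := by
  refine indec_induction (P := fun x => ∀ M', cls M' = x → IsSummand N (syz^[k] M') →
    N.IsProj ∨ IsSummand N (syz^[k] V)) ?_ ?_ M ?_ M rfl h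
  · intro M' hM' h
    have hK : toK0 (syz^[k] M') = toK0 (zeroMod S) := by
      rw [← hL.pow_toK0, toK0_congr (hM'.trans cls_zeroMod.symm), toK0_zeroMod, map_zero]
    exact (hN.isProj_or_summand hK h).elim Or.inl fun h => Or.inl (isProj_zeroMod.of_isSummand h)
  · intro x y hx hy M' hM' h
    obtain ⟨A, rfl⟩ := exists_cls x
    obtain ⟨B, rfl⟩ := exists_cls y
    rcases hN.isProj_or_summand_iterate_syz_of_add hL hM' h with h | h | h
    · exact Or.inl h
    · exact hx A rfl h
    · exact hy B rfl h
  · intro I hI hIM M' hM' h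
    obtain ⟨j, f, hf, hMf⟩ := hM
    obtain ⟨i, hi⟩ := hI.exists_of_isSummand_dsum (hIM.trans hMf)
    rw [show f i = V from hf i] at hi
    obtain ⟨x, hx⟩ := isSummand_iff.1 hi
    obtain ⟨X, rfl⟩ := exists_cls x
    have hK : toK0 (syz^[k] M') = toK0 (syz^[k] I) := by
      rw [← hL.pow_toK0, ← hL.pow_toK0, toK0_congr hM']
    refine (hN.isProj_or_summand hK h).elim Or.inl fun h => ?_
    have hV : toK0 (prodMod (syz^[k] I) (syz^[k] X)) = toK0 (syz^[k] V) := by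
      rw [toK0_prodMod, ← hL.pow_toK0, ← hL.pow_toK0, ← hL.pow_toK0, toK0_of_cls_eq_add hx,
        map_add]
    exact hN.isProj_or_summand hV (h.trans (isSummand_iff.2 ⟨cls (syz^[k] X), rfl⟩))

/-- An exact sequence `0 → X → Y → Z → 0` whose first two terms agree in `K₀` bounds the projective
dimension of `Z` by that of a summand of `X ⊕ P` with `P` projective. -/
theorem StSES.pdLT_of_toK0_eq {X Y Z : FGMod S} (h : StSES X Y Z) (hXY : toK0 X = toK0 Y)
    {m b : ℕ} (hZ : PdLT Z (m + 1))
    (hb : ∀ N, Indec N → IsSummand N X → PdLT N (m + 1) → PdLT N (b + 1)) :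
    PdLT Z (b + 2) := by
  obtain ⟨P₁, P₂, P₃, hP₁, hP₂, hP₃, h⟩ := h
  obtain ⟨_, ⟨P₄, hP₄, rfl⟩, _, ⟨P₅, hP₅, rfl⟩, hst⟩ := stab_iff.2 hXY
  have hU := (h.prod_left P₄).prod_right (FGMod.prodMod P₅ P₁)
  have hmid : cls (FGMod.prodMod (FGMod.prodMod (FGMod.prodMod Y P₂) P₄) (FGMod.prodMod P₅ P₁)) =
      cls (FGMod.prodMod (FGMod.prodMod (FGMod.prodMod X P₁) P₄) (FGMod.prodMod P₂ P₄)) := by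
    change cls Y + cls P₂ + cls P₄ + (cls P₅ + cls P₁) =
      cls X + cls P₁ + cls P₄ + (cls P₂ + cls P₄)
    calc _ = (cls Y + cls P₅) + (cls P₁ + cls P₂ + cls P₄) := by ac_rfl
      _ = (cls X + cls P₄) + (cls P₁ + cls P₂ + cls P₄) := by rw [hst]
      _ = _ := by ac_rfl
  obtain ⟨W, a, c, g, hWU, ha, hinj, hg, hag⟩ := (hU.congr rfl hmid rfl).exists_nilpotent
  have hQ : Module.Projective S (FGMod.prodMod P₂ P₄).carrier := hP₂.prodMod hP₄
  have hW : PdLT W (m + 1) := hasProjectiveDimensionLT_of_isNilpotent ha hinj hg hag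
    ((hZ.prodMod (hP₃.pdLT m)).prodMod ((hP₅.prodMod hP₁).pdLT m) |>.mono (Nat.le_succ _))
  have hWb : PdLT W (b + 1) := by
    refine pdLT_of_indec fun N hN hNW => ?_
    obtain ⟨x, hx⟩ := isSummand_iff.1 (hNW.trans hWU)
    rcases hN.summand_or hx.symm with h | h
    · obtain ⟨y, hy⟩ := isSummand_iff.1 h
      rcases hN.summand_or hy.symm with h | h
      · exact hb N hN h (hNW.pdLT hW)
      · exact h.pdLT (hP₁.pdLT b)
    · exact h.pdLT (hP₄.pdLT b)
  have hSES : SES W (FGMod.prodMod W (FGMod.prodMod P₂ P₄))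
      (FGMod.prodMod (FGMod.prodMod Z P₃) (FGMod.prodMod P₅ P₁)) := ⟨a.prod c, g, hinj, hg, hag⟩
  refine IsSummand.pdLT ?_ (hSES.pdLT_right hWb
    ((hWb.prodMod ((hP₂.prodMod hP₄).pdLT b)).mono (Nat.le_succ _)))
  exact isSummand_iff.2 ⟨cls P₃ + (cls P₅ + cls P₁), add_assoc (cls Z) (cls P₃) (cls P₅ + cls P₁)⟩

end FGMod

theorem IsZeroIT.isProj_of_pdLT {L : AddMonoid.End (K0 S)} (hL : IsSyzEnd L)
    {D : Set (FGMod S)} (hD : IsZeroIT L D) {N E : FGMod S} (hE : E ∈ D) (hN : IsSummand N E)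
    {m : ℕ} (h : PdLT N (m + 1)) : N.IsProj := by
  refine isProj_of_toK0_eq_zero (hD.eq_zero_of_pow_eq_zero (toK0_mem_grpOf hE hN) (k := m) ?_)
  rw [hL.pow_toK0]
  exact toK0_of_isProj (pdLT_one_iff.1 ((pdLT_iterate_syz (j := 0) m).2 h))

/-- After `φ_[D](V)` syzygies the first two terms of the sequence agree already in `K₀`. -/
theorem toK0_iterate_syz_eq_of_stSES {V : FGMod S} {D : Set (FGMod S)}
    {L : AddMonoid.End (K0 S)} (hL : IsSyzEnd L) {LD : AddMonoid.End (KD D)}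
    (hLD : IsSyzEndD D LD) (hD : IsZeroIT L D) {V₁ V₀ D₁ D₀ Z : FGMod S} (hV₁ : V₁ ∈ addOf {V})
    (hV₀ : V₀ ∈ addOf {V}) (hD₁ : D₁ ∈ D) (hD₀ : D₀ ∈ D)
    (h : StSES (prodMod V₁ D₁) (prodMod V₀ D₀) Z) {m : ℕ} (hZ : PdLT Z (m + 1)) :
    toK0 (syz^[phiD D LD V] (prodMod V₁ D₁)) = toK0 (syz^[phiD D LD V] (prodMod V₀ D₀)) := by
  set x : K0 S := toK0 (prodMod V₁ D₁) - toK0 (prodMod V₀ D₀) with hx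
  have hpow : (L ^ m) x = 0 := by
    rw [hx, map_sub, hL.pow_toK0, hL.pow_toK0, sub_eq_zero]
    exact (h.syz_iterate m).toK0_eq (pdLT_one_iff.1 ((pdLT_iterate_syz (j := 0) m).2 hZ))
  have hmem : QuotientAddGroup.mk' (grpOf D) x ∈
      (grpOf {V}).map (QuotientAddGroup.mk' (grpOf D)) := by
    refine ⟨toK0 V₁ - toK0 V₀, sub_mem (toK0_mem_grpOf_of_mem_addOf hV₁)
      (toK0_mem_grpOf_of_mem_addOf hV₀), ?_⟩
    refine (QuotientAddGroup.mk'_eq_mk' _).2 ⟨toK0 D₁ - toK0 D₀,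
      sub_mem (toK0_mem_grpOf hD₁ (.refl _)) (toK0_mem_grpOf hD₀ (.refl _)), ?_⟩
    rw [hx, toK0_prodMod, toK0_prodMod]
    abel
  obtain ⟨T, hT, hle⟩ := exists_finite_grpOf_le V
  have hphi : (LD ^ phiD D LD V) (QuotientAddGroup.mk' (grpOf D) x) = 0 := by
    refine pow_eta_eq_zero LD (hT.image (QuotientAddGroup.mk' (grpOf D))) ?_ hmem (k := m) ?_
    · rw [← AddMonoidHom.map_closure]
      exact AddSubgroup.map_mono hle
    · rw [hLD.pow_mk hL, hpow, map_zero]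
  rw [hLD.pow_mk hL] at hphi
  have hzero := hD.eq_zero_of_pow_eq_zero ((QuotientAddGroup.eq_zero_iff _).1 hphi) (k := m) <| by
    rw [← Function.comp_apply (f := L ^ m), ← AddMonoid.End.coe_mul, ← pow_add, add_comm, pow_add,
      AddMonoid.End.coe_mul, Function.comp_apply, hpow, map_zero]
  rwa [hx, map_sub, hL.pow_toK0, hL.pow_toK0, sub_eq_zero] at hzero

theorem psiD_lt_top (D : Set (FGMod S)) (LD : AddMonoid.End (KD D)) (V : FGMod S) :
    psiD D LD V < ⊤ :=
  ENat.add_lt_top.2 ⟨ENat.natCast_lt_top _, findim_addOf_singleton_lt_top _⟩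

theorem findim_univ_le_of_isLITClass {n : ℕ} {V : FGMod S} {D : Set (FGMod S)}
    {L : AddMonoid.End (K0 S)} (hL : IsSyzEnd L) {LD : AddMonoid.End (KD D)}
    (hLD : IsSyzEndD D LD) (hD : IsZeroIT L D) (hLIT : IsLITClass n V D Set.univ) :
    findim (Set.univ : Set (FGMod S)) ≤ psiD D LD V + n + 1 := by
  refine iSup₂_le fun M hM => ?_
  obtain ⟨m, hm⟩ := pdim_ne_top_iff.1 hM.2
  obtain ⟨V₁, V₀, D₁, D₀, hV₁, hV₀, hD₁, hD₀, h⟩ := hLIT M trivial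
  obtain ⟨b, hb⟩ := ENat.ne_top_iff_exists.1
    (findim_addOf_singleton_lt_top (syz^[phiD D LD V] V)).ne
  have hfin : ∀ N ∈ addOf {syz^[phiD D LD V] V}, PdLT N (m + 1) → PdLT N (b + 1) := fun N hN hk =>
    pdim_le_iff.1 (hb ▸ le_iSup₂ (f := fun N _ => pdim N) N ⟨hN, pdim_ne_top_iff.2 ⟨m, hk⟩⟩)
  have hsyz : ∀ k, PdLT (syz^[k] M) (m + 1) := fun k =>
    (pdLT_iterate_syz k).2 (hm.mono (by lia))
  have hXY := toK0_iterate_syz_eq_of_stSES hL hLD hD hV₁ hV₀ hD₁ hD₀ h.stSES (hsyz n)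
  have hDsyz : ∀ k, syz^[k] D₁ ∈ D := fun k => by
    induction k with
    | zero => exact hD₁
    | succ k ih => exact Function.iterate_succ_apply' syz k D₁ ▸ hD.2.1 _ ih
  have hZ := (h.stSES.syz_iterate (phiD D LD V)).pdLT_of_toK0_eq hXY (m := m) (b := b)
    (by rw [← Function.iterate_add_apply]; exact hsyz _) fun N hN hNX hNm => by
      rcases hN.isProj_or_summand_iterate_syz_of_add hL (B := D₁) rfl hNX with h | h | h
      · exact h.pdLT b
      · rcases hN.isProj_or_summand_iterate_syz hL hV₁ h with h | h
        · exact h.pdLT b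
        · exact hfin N (mem_addOf_of_isSummand rfl h) hNm
      · exact (hD.isProj_of_pdLT hL (hDsyz _) h hNm).pdLT b
  rw [← Function.iterate_add_apply, pdLT_iterate_syz (j := b + 1)] at hZ
  rw [psiD, ← hb]
  refine (pdim_le_iff.2 hZ).trans (le_of_eq ?_)
  push_cast
  ring

end Artinian

/-!
STATEMENT 5 (Theorem of [BLMV]).  Let `A` be an `(n, V, D)`-Lat-Igusa-Todorov algebra.
Then `findim(A) ≤ ψ_[D](V) + n + 1 < ∞`.
Here `L` (resp. `LD`) is the endomorphism of `K₀(A)` (resp. of `K_D(A)`) induced by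
the syzygy operator.
-/
theorem stmt_5 (R A : Type u) [CommRing R] [IsArtinianRing R] [Ring A] [Algebra R A]
    [Module.Finite R A]
    (n : ℕ) (V : FGMod Aᵐᵒᵖ) (D : Set (FGMod Aᵐᵒᵖ))
    (L : AddMonoid.End (K0 Aᵐᵒᵖ)) (hL : IsSyzEnd L)
    (LD : AddMonoid.End (KD D)) (hLD : IsSyzEndD D LD)
    (hD : IsZeroIT L D)
    (hLIT : IsLITClass n V D Set.univ) :
    findim (Set.univ : Set (FGMod Aᵐᵒᵖ)) ≤ psiD D LD V + n + 1 ∧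
      psiD D LD V + n + 1 < ⊤ := by
  have h : IsArtinian R Aᵐᵒᵖ := by
    have : Module.Finite R Aᵐᵒᵖ := Module.Finite.equiv (MulOpposite.opLinearEquiv R)
    infer_instance
  have : IsArtinianRing Aᵐᵒᵖ := isArtinian_of_tower R h
  refine ⟨findim_univ_le_of_isLITClass hL hLD hD hLIT, ?_⟩
  exact ENat.add_lt_top.2 ⟨ENat.add_lt_top.2 ⟨psiD_lt_top D LD V, ENat.natCast_lt_top n⟩,
    ENat.one_lt_top⟩
end LIT
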